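/- arXiv:1604.03030 — 3 statements merged into one kernel-verified Lean document; each statement's English description precedes it below -/
import Mathlib

section
/- A uniformly random q-tuple of points in [n]×[n] is well-separated with probability at least 1 − 2^{−0.4·q·log log n}, for sufficiently large n. More precisely, the probability that fewer than q/2 points avoid the 'not-far' regions of all earlier points (each region having probability mass at most 17/log n) is at most 2^q·(17/log n)^{q/2} ≤ 2^{−0.4 q log log n}. -/
open Finset in
/-- A generating-function bound for the number of coordinates of a tuple that are `R`-related to
some later coordinate, when every point has at most `M` relatives. -/
theorem sum_prod_ite_exists_later_le {α : Type*} [Fintype α] (R : α → α → Prop)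
    [DecidableRel R] {M t : ℝ} (ht : 1 ≤ t)
    (hM : ∀ b, (#{a | R a b} : ℝ) ≤ M) {K : ℝ} (m : ℕ) (hK : m * M ≤ K) (hM0 : 0 ≤ M) :
    ∑ f : Fin m → α, ∏ i, (if ∃ j, i < j ∧ R (f i) (f j) then t else 1)
      ≤ (Fintype.card α + t * K) ^ m := by
  induction m with
  | zero => simp
  | succ m ih =>
    have hmK : m * M ≤ K := by push_cast at hK; linarith
    have hK0 : 0 ≤ K := le_trans (by positivity) hmK
    have hhead (f : Fin m → α) :
        ∑ a, (if ∃ j, R a (f j) then t else 1) ≤ Fintype.card α + t * K := by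
      have hcard : (#{a | ∃ j, R a (f j)} : ℝ) ≤ K := by
        classical
        have hsub : ({a | ∃ j, R a (f j)} : Finset α) ⊆
            univ.biUnion fun j => ({a | R a (f j)} : Finset α) := by
          intro a
          simp
        calc (#{a | ∃ j, R a (f j)} : ℝ)
            ≤ #(univ.biUnion fun j => ({a | R a (f j)} : Finset α)) := by
              exact_mod_cast card_le_card hsub
          _ ≤ ∑ j, (#{a | R a (f j)} : ℝ) := by exact_mod_cast card_biUnion_le
          _ ≤ ∑ _j : Fin m, M := sum_le_sum fun j _ => hM _
          _ = m * M := by simp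
          _ ≤ K := hmK
      calc ∑ a, (if ∃ j, R a (f j) then t else 1)
          ≤ ∑ a, (1 + t * if ∃ j, R a (f j) then 1 else 0) := by
            refine sum_le_sum fun a _ => ?_
            split_ifs <;> linarith
        _ = Fintype.card α + t * #{a | ∃ j, R a (f j)} := by
            rw [sum_add_distrib, ← mul_sum, sum_boole]
            simp
        _ ≤ _ := by gcongr
    rw [← (Fin.consEquiv fun _ => α).sum_comp, Fintype.sum_prod_type_right]
    calc _ = ∑ f : Fin m → α, (∑ a, (if ∃ j, R a (f j) then t else 1)) *
            ∏ i, (if ∃ j, i < j ∧ R (f i) (f j) then t else 1) := by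
          refine sum_congr rfl fun f _ => ?_
          rw [sum_mul]
          refine sum_congr rfl fun a _ => ?_
          simp [Fin.prod_univ_succ, Fin.exists_fin_succ, Fin.consEquiv]
      _ ≤ ∑ f : Fin m → α, (Fintype.card α + t * K) *
            ∏ i, (if ∃ j, i < j ∧ R (f i) (f j) then t else 1) := by
          refine sum_le_sum fun f _ => mul_le_mul_of_nonneg_right (hhead f) ?_
          exact prod_nonneg fun i _ => by split_ifs <;> linarith
      _ ≤ (Fintype.card α + t * K) * (Fintype.card α + t * K) ^ m := by
          rw [← mul_sum]
          exact mul_le_mul_of_nonneg_left (ih hmK) (by positivity)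
      _ = _ := by ring

open Finset in
theorem card_filter_abs_sub_lt_le {n : ℕ} (b : Fin n) {c : ℝ} (hc : 0 ≤ c) :
    (#{y : Fin n | |((y : ℕ) : ℝ) - ((b : ℕ) : ℝ)| < c} : ℝ) ≤ 1 + 2 * c := by
  have hle : #{y : Fin n | |((y : ℕ) : ℝ) - ((b : ℕ) : ℝ)| < c} ≤
      #(Icc ((b : ℕ) - ⌊c⌋₊) (b + ⌊c⌋₊)) := by
    refine card_le_card_of_injOn (fun y => (y : ℕ)) ?_ (Fin.val_injective.injOn)
    intro y hy
    have hy' := abs_lt.1 (mem_filter.1 hy).2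
    have h1 : (y : ℕ) - (b : ℕ) ≤ ⌊c⌋₊ := by
      rcases le_total (y : ℕ) b with h | h
      · omega
      · exact Nat.le_floor (by push_cast [h]; linarith)
    have h2 : (b : ℕ) - (y : ℕ) ≤ ⌊c⌋₊ := by
      rcases le_total (b : ℕ) y with h | h
      · omega
      · exact Nat.le_floor (by push_cast [h]; linarith)
    simp only [coe_Icc, Set.mem_Icc]
    omega
  have hle' : #{y : Fin n | |((y : ℕ) : ℝ) - ((b : ℕ) : ℝ)| < c} ≤ 1 + 2 * ⌊c⌋₊ := by
    refine hle.trans ?_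
    rw [Nat.card_Icc]
    omega
  calc _ ≤ ((1 + 2 * ⌊c⌋₊ : ℕ) : ℝ) := by exact_mod_cast hle'
    _ ≤ _ := by push_cast; linarith [Nat.floor_le hc]

open Finset in
theorem sum_inv_abs_sub_le {n : ℕ} (a : Fin n) :
    ∑ x : Fin n, |((x : ℕ) : ℝ) - ((a : ℕ) : ℝ)|⁻¹ ≤ 2 * (1 + Real.log n) := by
  have key (s : Finset (Fin n)) (g : Fin n → ℕ) (hg : Set.InjOn g s) (hlt : ∀ x ∈ s, g x < n) :
      ∑ x ∈ s, ((g x : ℝ) + 1)⁻¹ ≤ 1 + Real.log n := by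
    calc ∑ x ∈ s, ((g x : ℝ) + 1)⁻¹ = ∑ k ∈ s.image g, ((k : ℝ) + 1)⁻¹ := by
          rw [sum_image hg]
      _ ≤ ∑ k ∈ range n, ((k : ℝ) + 1)⁻¹ := by
          refine sum_le_sum_of_subset_of_nonneg ?_ fun _ _ _ => by positivity
          intro k hk
          obtain ⟨x, hx, rfl⟩ := mem_image.1 hk
          exact mem_range.2 (hlt x hx)
      _ = (harmonic n : ℝ) := by simp [harmonic]
      _ ≤ _ := harmonic_le_one_add_log n
  have hpos : ∑ x ∈ univ.filter (a < ·), |((x : ℕ) : ℝ) - ((a : ℕ) : ℝ)|⁻¹ ≤ 1 + Real.log n := by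
    refine le_of_eq_of_le (sum_congr rfl fun x hx => ?_)
      (key (univ.filter (a < ·)) (fun x => (x : ℕ) - a - 1) ?_ ?_)
    · have h : (a : ℕ) + 1 ≤ x := (mem_filter.1 hx).2
      obtain ⟨d, hd⟩ := Nat.exists_eq_add_of_le h
      have hd' : (x : ℕ) - a - 1 = d := by omega
      rw [hd', hd]
      push_cast
      rw [abs_of_nonneg (by linarith [d.cast_nonneg (α := ℝ)])]
      ring_nf
    · intro x hx y hy hxy
      have h1 : (a : ℕ) < x := (mem_filter.1 hx).2
      have h2 : (a : ℕ) < y := (mem_filter.1 hy).2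
      ext
      simp only at hxy
      omega
    · intro x hx
      omega
  have hneg : ∑ x ∈ univ.filter (¬ a < ·), |((x : ℕ) : ℝ) - ((a : ℕ) : ℝ)|⁻¹ ≤
      1 + Real.log n := by
    have hsub : univ.filter (· < a) ⊆ univ.filter (¬ a < ·) := by
      intro x
      simp only [mem_filter, mem_univ, true_and]
      exact fun h => h.le.not_gt
    rw [← sum_subset hsub]
    · refine le_of_eq_of_le (sum_congr rfl fun x hx => ?_)
        (key (univ.filter (· < a)) (fun x => (a : ℕ) - x - 1) ?_ ?_)
      · have h : (x : ℕ) + 1 ≤ a := (mem_filter.1 hx).2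
        obtain ⟨d, hd⟩ := Nat.exists_eq_add_of_le h
        have hd' : (a : ℕ) - x - 1 = d := by omega
        rw [hd', hd]
        push_cast
        rw [abs_sub_comm, abs_of_nonneg (by linarith [d.cast_nonneg (α := ℝ)])]
        ring_nf
      · intro x hx y hy hxy
        have h1 : (x : ℕ) < a := (mem_filter.1 hx).2
        have h2 : (y : ℕ) < a := (mem_filter.1 hy).2
        ext
        simp only at hxy
        omega
      · intro x hx
        omega
    · intro x hx hx'
      simp only [mem_filter, mem_univ, true_and, not_lt] at hx hx'
      rw [le_antisymm hx hx']
      simp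
  rw [← sum_filter_add_sum_filter_not univ (a < ·)]
  linarith

open Finset in
/-- The region `|x - a| * |y - b| < A` around a point of the grid has at most
`2 * n + 4 * A * (1 + log n)` points. -/
theorem card_filter_abs_mul_abs_lt_le {n : ℕ} (p : Fin n × Fin n) {A : ℝ} (hA : 0 ≤ A) :
    (#{r : Fin n × Fin n | |((r.1 : ℕ) : ℝ) - ((p.1 : ℕ) : ℝ)| *
        |((r.2 : ℕ) : ℝ) - ((p.2 : ℕ) : ℝ)| < A} : ℝ) ≤ 2 * n + 4 * A * (1 + Real.log n) := by
  have hrow (x : Fin n) :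
      (#{y : Fin n | |((x : ℕ) : ℝ) - ((p.1 : ℕ) : ℝ)| *
        |((y : ℕ) : ℝ) - ((p.2 : ℕ) : ℝ)| < A} : ℝ) ≤
      (if x = p.1 then (n : ℝ) else 0) +
        (1 + 2 * (A * |((x : ℕ) : ℝ) - ((p.1 : ℕ) : ℝ)|⁻¹)) := by
    split_ifs with hx
    · have : (#{y : Fin n | |((x : ℕ) : ℝ) - ((p.1 : ℕ) : ℝ)| *
          |((y : ℕ) : ℝ) - ((p.2 : ℕ) : ℝ)| < A} : ℝ) ≤ n := by
        exact_mod_cast (card_le_univ _).trans_eq (Fintype.card_fin n)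
      have h0 : 0 ≤ 2 * (A * |((x : ℕ) : ℝ) - ((p.1 : ℕ) : ℝ)|⁻¹) := by positivity
      linarith
    · have hd : 0 < |((x : ℕ) : ℝ) - ((p.1 : ℕ) : ℝ)| := by
        refine abs_pos.2 (sub_ne_zero.2 fun h => hx (Fin.ext ?_))
        exact_mod_cast h
      rw [zero_add]
      convert card_filter_abs_sub_lt_le p.2
        (c := A * |((x : ℕ) : ℝ) - ((p.1 : ℕ) : ℝ)|⁻¹) (by positivity) using 4 with y
      rw [← div_eq_mul_inv, lt_div_iff₀ hd, mul_comm]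
  calc _ = ∑ x : Fin n, (#{y : Fin n | |((x : ℕ) : ℝ) - ((p.1 : ℕ) : ℝ)| *
        |((y : ℕ) : ℝ) - ((p.2 : ℕ) : ℝ)| < A} : ℝ) := by
        simp only [card_filter, Fintype.sum_prod_type, Nat.cast_sum]
    _ ≤ ∑ x : Fin n, ((if x = p.1 then (n : ℝ) else 0) +
        (1 + 2 * (A * |((x : ℕ) : ℝ) - ((p.1 : ℕ) : ℝ)|⁻¹))) := sum_le_sum fun x _ => hrow x
    _ = 2 * n + 2 * (A * ∑ x : Fin n, |((x : ℕ) : ℝ) - ((p.1 : ℕ) : ℝ)|⁻¹) := by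
        simp only [sum_add_distrib, ← mul_sum]
        simp
        ring
    _ ≤ 2 * n + 2 * (A * (2 * (1 + Real.log n))) := by
        gcongr
        exact sum_inv_abs_sub_le p.1
    _ = _ := by ring

open Finset in
/-- Markov's inequality for the number of coordinates related to a later one: at most
`(2 * |α|) ^ q * P ^ (q / 2)` tuples fail to contain `q / 2` pairwise unrelated coordinates. -/
theorem card_filter_not_exists_pairwise_le {α : Type*} [Fintype α] (R : α → α → Prop)
    [DecidableRel R] (hR : ∀ a b, R a b → R b a) {M P : ℝ} (hM0 : 0 ≤ M) (hP0 : 0 < P) (hP1 : P ≤ 1)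
    (hM : ∀ b, (#{a | R a b} : ℝ) ≤ M) (q : ℕ) (hq : q * M ≤ Fintype.card α * P)
    (S : Finset (Fin q → α))
    (hS : ∀ f ∈ S, ¬ ∃ s : Finset (Fin q), (q : ℝ) / 2 ≤ #s ∧
      ∀ i ∈ s, ∀ j ∈ s, i ≠ j → ¬ R (f i) (f j)) :
    (#S : ℝ) ≤ (2 * Fintype.card α) ^ q * P ^ ((q : ℝ) / 2) := by
  have hbad (f) (hf : f ∈ S) : P⁻¹ ^ ((q : ℝ) / 2) ≤
      ∏ i, (if ∃ j, i < j ∧ R (f i) (f j) then P⁻¹ else 1) := by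
    have hlt : (#{i : Fin q | ¬ ∃ j, i < j ∧ R (f i) (f j)} : ℝ) < q / 2 := by
      by_contra hcon
      refine hS f hf ⟨_, not_lt.1 hcon, fun i hi j hj hij => ?_⟩
      have hi' := (mem_filter.1 hi).2
      have hj' := (mem_filter.1 hj).2
      rcases lt_or_gt_of_ne hij with h | h
      · exact fun hr => hi' ⟨j, h, hr⟩
      · exact fun hr => hj' ⟨i, h, hR _ _ hr⟩
    have hadd : (#{i : Fin q | ∃ j, i < j ∧ R (f i) (f j)} : ℝ) +
        #{i : Fin q | ¬ ∃ j, i < j ∧ R (f i) (f j)} = q := by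
      have := card_filter_add_card_filter_not (s := (univ : Finset (Fin q)))
        (fun i => ∃ j, i < j ∧ R (f i) (f j))
      rw [card_univ, Fintype.card_fin] at this
      exact_mod_cast this
    rw [prod_ite, prod_const, prod_const_one, mul_one, ← Real.rpow_natCast]
    exact Real.rpow_le_rpow_of_exponent_le ((one_le_inv₀ hP0).2 hP1) (by linarith)
  have hsum : (#S : ℝ) * P⁻¹ ^ ((q : ℝ) / 2) ≤ (2 * Fintype.card α) ^ q := by
    calc (#S : ℝ) * P⁻¹ ^ ((q : ℝ) / 2) = ∑ _f ∈ S, P⁻¹ ^ ((q : ℝ) / 2) := by simp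
      _ ≤ ∑ f ∈ S, ∏ i, (if ∃ j, i < j ∧ R (f i) (f j) then P⁻¹ else 1) := sum_le_sum hbad
      _ ≤ ∑ f : Fin q → α, ∏ i, (if ∃ j, i < j ∧ R (f i) (f j) then P⁻¹ else 1) := by
          refine sum_le_sum_of_subset_of_nonneg (subset_univ S) fun f _ _ => ?_
          exact prod_nonneg fun i _ => by split_ifs <;> positivity
      _ ≤ (Fintype.card α + P⁻¹ * (Fintype.card α * P)) ^ q :=
          sum_prod_ite_exists_later_le R ((one_le_inv₀ hP0).2 hP1) hM q hq hM0
      _ = _ := by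
          congr 1
          field_simp
          ring
  rwa [Real.inv_rpow hP0.le, ← div_eq_mul_inv, div_le_iff₀ (by positivity)] at hsum

theorem two_pow_mul_rpow_le_rpow {L : ℝ} (hL : 9 ^ 10 ≤ L) (q : ℕ) :
    2 ^ q * (17 / L) ^ ((q : ℝ) / 2) ≤ (2 : ℝ) ^ (-(0.4 : ℝ) * q * Real.logb 2 L) := by
  have hL0 : 0 < L := lt_of_lt_of_le (by norm_num) hL
  have hrhs : (2 : ℝ) ^ (-(0.4 : ℝ) * q * Real.logb 2 L) = (L ^ (-(0.4 : ℝ))) ^ q := by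
    rw [mul_comm, Real.rpow_mul (by norm_num), Real.rpow_logb (by norm_num) (by norm_num) hL0,
      Real.rpow_mul hL0.le, Real.rpow_natCast]
  have hlhs : 2 ^ q * (17 / L) ^ ((q : ℝ) / 2) = (2 * (17 / L) ^ (1 / 2 : ℝ)) ^ q := by
    rw [mul_pow, ← Real.rpow_natCast ((17 / L) ^ (1 / 2 : ℝ)), ← Real.rpow_mul (by positivity)]
    ring_nf
  rw [hrhs, hlhs]
  refine pow_le_pow_left₀ (by positivity) ?_ q
  have hroot : (9 : ℝ) ≤ L ^ (0.1 : ℝ) := by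
    calc (9 : ℝ) = ((9 : ℝ) ^ (10 : ℕ)) ^ (0.1 : ℝ) := by
          rw [← Real.rpow_natCast, ← Real.rpow_mul (by norm_num)]
          norm_num
      _ ≤ _ := Real.rpow_le_rpow (by norm_num) hL (by norm_num)
  have hsqrt : (17 : ℝ) ^ (1 / 2 : ℝ) ≤ 4.5 := by
    rw [← Real.sqrt_eq_rpow, Real.sqrt_le_left (by norm_num)]
    norm_num
  have hsplit : L ^ (-(0.4 : ℝ)) = L ^ (0.1 : ℝ) / L ^ (1 / 2 : ℝ) := by
    rw [← Real.rpow_sub hL0]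
    norm_num
  rw [hsplit, Real.div_rpow (by norm_num) hL0.le, ← mul_div_assoc]
  gcongr
  linarith

theorem mul_card_bound_le {n q L : ℝ} (hn : 0 < n) (hq : 0 < q) (hL : 9 ^ 10 ≤ L)
    (hqn : q * L ^ 2 ≤ n) :
    q * (2 * n + 4 * (4 * n ^ 2 / (q * L ^ 2)) * (1 + Real.log 2 * L)) ≤ n * n * (17 / L) := by
  have hL0 : 0 < L := lt_of_lt_of_le (by norm_num) hL
  have hlog := Real.log_two_lt_d9
  have heq : q * (2 * n + 4 * (4 * n ^ 2 / (q * L ^ 2)) * (1 + Real.log 2 * L)) =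
      (2 * n * (q * L ^ 2) + 16 * n ^ 2 * (1 + Real.log 2 * L)) / L ^ 2 := by
    field_simp
    ring
  rw [heq, div_le_iff₀ (by positivity)]
  have hrhs : n * n * (17 / L) * L ^ 2 = n ^ 2 * (17 * L) := by
    field_simp
  rw [hrhs]
  calc 2 * n * (q * L ^ 2) + 16 * n ^ 2 * (1 + Real.log 2 * L)
      ≤ 2 * n * n + 16 * n ^ 2 * (1 + 0.7 * L) := by
        gcongr
        linarith
    _ = n ^ 2 * (18 + 11.2 * L) := by ring
    _ ≤ n ^ 2 * (17 * L) := by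
        gcongr
        linarith


open Classical Real Finset in
/-- A uniformly random `q`-tuple of points in `[n] × [n]` is well-separated
(contains a subtuple of size ≥ q/2 that is pairwise far, i.e. the product of
coordinate differences is at least `Aα = 4n²/(q log² n)`) with probability at
least `1 − 2^{−0.4 q log log n}`. -/
theorem stmt2 :
    ∃ N : ℕ, ∀ n ≥ N, ∀ q : ℕ, 1 ≤ q →
      (q : ℝ) * (Real.logb 2 n) ^ 2 ≤ (n : ℝ) →
      (1 : ℝ) - 2 ^ (-(0.4 : ℝ) * (q : ℝ) * Real.logb 2 (Real.logb 2 n)) ≤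
        ((Finset.univ.filter (fun f : Fin q → Fin n × Fin n =>
            ∃ s : Finset (Fin q), (q : ℝ) / 2 ≤ (s.card : ℝ) ∧
              ∀ i ∈ s, ∀ j ∈ s, i ≠ j →
                4 * (n : ℝ) ^ 2 / ((q : ℝ) * (Real.logb 2 n) ^ 2) ≤
                  |(((f i).1 : ℕ) : ℝ) - (((f j).1 : ℕ) : ℝ)| *
                  |(((f i).2 : ℕ) : ℝ) - (((f j).2 : ℕ) : ℝ)|)).card : ℝ)
          / ((n : ℝ) ^ 2) ^ q := by
  obtain ⟨N, hN⟩ := Filter.eventually_atTop.1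
    (((Real.tendsto_logb_atTop (b := 2) (by norm_num)).comp
      (tendsto_natCast_atTop_atTop (R := ℝ))).eventually_ge_atTop (9 ^ 10))
  refine ⟨max N 1, fun n hn q hq hqn => ?_⟩
  have hn1 : 1 ≤ n := (le_max_right _ _).trans hn
  have hn0 : (0 : ℝ) < n := by exact_mod_cast hn1
  have hq0 : (0 : ℝ) < q := by exact_mod_cast hq
  have hL : 9 ^ 10 ≤ Real.logb 2 n := hN n ((le_max_left _ _).trans hn)
  have hlog : Real.log n = Real.log 2 * Real.logb 2 n := by
    rw [Real.logb, mul_div_cancel₀ _ (Real.log_pos one_lt_two).ne']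
  set L := Real.logb 2 n
  have hL0 : 0 < L := lt_of_lt_of_le (by norm_num) hL
  set A := 4 * (n : ℝ) ^ 2 / ((q : ℝ) * L ^ 2)
  have hA : 0 ≤ A := by positivity
  set W := Finset.univ.filter (fun f : Fin q → Fin n × Fin n =>
    ∃ s : Finset (Fin q), (q : ℝ) / 2 ≤ (s.card : ℝ) ∧
      ∀ i ∈ s, ∀ j ∈ s, i ≠ j →
        A ≤ |(((f i).1 : ℕ) : ℝ) - (((f j).1 : ℕ) : ℝ)| *
          |(((f i).2 : ℕ) : ℝ) - (((f j).2 : ℕ) : ℝ)|) with hW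
  have hcardα : (Fintype.card (Fin n × Fin n) : ℝ) = n * n := by simp
  have hcompl : (#Wᶜ : ℝ) ≤ (2 * (n * n)) ^ q * (17 / L) ^ ((q : ℝ) / 2) := by
    rw [← hcardα]
    refine card_filter_not_exists_pairwise_le
      (fun r p : Fin n × Fin n => |((r.1 : ℕ) : ℝ) - ((p.1 : ℕ) : ℝ)| *
        |((r.2 : ℕ) : ℝ) - ((p.2 : ℕ) : ℝ)| < A)
      (fun r p h => ?_) (M := 2 * n + 4 * A * (1 + Real.log n)) ?_ (by positivity) ?_
      (fun p => ?_) q ?_ Wᶜ fun f hf => ?_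
    · beta_reduce at h ⊢
      rwa [abs_sub_comm (((p.1 : ℕ) : ℝ)), abs_sub_comm (((p.2 : ℕ) : ℝ))]
    · have := Real.log_natCast_nonneg n
      positivity
    · rw [div_le_one hL0]
      linarith
    · convert card_filter_abs_mul_abs_lt_le p hA
    · rw [hcardα, hlog]
      exact mul_card_bound_le hn0 hq0 hL hqn
    · simpa only [hW, mem_compl, mem_filter, mem_univ, true_and, not_lt] using hf
  have htotal : (#W : ℝ) + #Wᶜ = ((n : ℝ) ^ 2) ^ q := by
    have := card_add_card_compl W
    rw [Fintype.card_fun, Fintype.card_prod, Fintype.card_fin, Fintype.card_fin] at this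
    rw [sq]
    exact_mod_cast this
  have hnum := two_pow_mul_rpow_le_rpow hL q
  rw [le_div_iff₀ (by positivity)]
  have hbound : (#Wᶜ : ℝ) ≤
      2 ^ (-(0.4 : ℝ) * (q : ℝ) * Real.logb 2 L) * ((n : ℝ) ^ 2) ^ q := by
    calc (#Wᶜ : ℝ) ≤ (2 * (n * n)) ^ q * (17 / L) ^ ((q : ℝ) / 2) := hcompl
      _ = 2 ^ q * (17 / L) ^ ((q : ℝ) / 2) * ((n : ℝ) ^ 2) ^ q := by
          rw [mul_pow, sq]
          ring
      _ ≤ _ := by gcongr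
  linarith
end

section
/- If a valid 4ANC protocol δ-solves a function f: X×Y → Z under a product input distribution μ = μ_x × μ_y with communication cost (c_A, c_B, c_M), then the communication matrix M(f) contains a combinatorial rectangle R = X'×Y' such that: (1) R is (δ/2)·2^{−c_M}-column-monochromatic with respect to μ; (2) μ_x(X') ≥ (δ/4)·2^{−(c_M + c_A + c_B)}; (3) μ_y(Y') ≥ (δ/4)·2^{−(c_M + c_B)}. -/
/-- The bit strings of length at most `n`. -/
def bitStrings : ℕ → Finset (List Bool)
  | 0 => {[]}
  | n + 1 => insert [] ((bitStrings n).image (List.cons true) ∪ (bitStrings n).image (List.cons false))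

theorem mem_bitStrings {n : ℕ} {l : List Bool} : l ∈ bitStrings n ↔ l.length ≤ n := by
  induction n generalizing l with
  | zero => simp [bitStrings]
  | succ n ih =>
    rcases l with _ | ⟨b, l⟩
    · simp [bitStrings]
    · cases b <;> simp [bitStrings, ih]

theorem card_bitStrings_lt (n : ℕ) : (bitStrings n).card + 1 ≤ 2 * 2 ^ n := by
  induction n with
  | zero => simp [bitStrings]
  | succ n ih =>
    have h1 := Finset.card_insert_le ([] : List Bool)
      ((bitStrings n).image (List.cons true) ∪ (bitStrings n).image (List.cons false))
    have h2 := Finset.card_union_le ((bitStrings n).image (List.cons true))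
      ((bitStrings n).image (List.cons false))
    have h3 := Finset.card_image_le (s := bitStrings n) (f := List.cons true)
    have h4 := Finset.card_image_le (s := bitStrings n) (f := List.cons false)
    rw [bitStrings, pow_succ]
    omega

/-- A prefix-free set of bit strings of length at most `n` has at most `2 ^ n` elements. -/
theorem card_le_of_prefixFree {n : ℕ} (s : Finset (List Bool)) (hs : ∀ l ∈ s, l.length ≤ n)
    (hpf : ∀ l ∈ s, ∀ l' ∈ s, l <+: l' → l = l') : s.card ≤ 2 ^ n := by
  have hcard : ((Finset.univ : Finset (List.Vector Bool n)).image List.Vector.toList).card ≤ 2 ^ n := by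
    refine Finset.card_image_le.trans ?_
    rw [Finset.card_univ, card_vector, Fintype.card_bool]
  refine le_trans (Finset.card_le_card_of_injOn
    (fun l => l ++ List.replicate (n - l.length) false) ?_ ?_) hcard
  · intro l hl
    have := hs l hl
    refine Finset.mem_image.2 ⟨⟨l ++ List.replicate (n - l.length) false, ?_⟩,
      Finset.mem_univ _, rfl⟩
    rw [List.length_append, List.length_replicate]
    omega
  · intro l hl l' hl' h
    have h1 : l <+: l ++ List.replicate (n - l.length) false := List.prefix_append _ _
    have h2 : l' <+: l ++ List.replicate (n - l.length) false := by
      simp only at h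
      rw [h]
      exact List.prefix_append _ _
    rcases List.prefix_or_prefix_of_prefix h1 h2 with h3 | h3
    · exact hpf l hl l' hl' h3
    · exact (hpf l' hl' l hl h3).symm

open Classical in
/-- A set of mass below `α` can be completed by a minimal set of elements of `Q` to mass at least
`α`. -/
theorem exists_minimal_filler {X : Type*} (μ : X → ℝ) (hμ : ∀ x, 0 ≤ μ x)
    (A Q : Finset X) (α : ℝ) (hQ : α ≤ ∑ x ∈ Q, μ x) :
    ∃ R ⊆ Q, Disjoint A R ∧ α ≤ ∑ x ∈ A, μ x + ∑ x ∈ R, μ x ∧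
      ∀ x ∈ R, ∑ x ∈ A, μ x + ∑ x ∈ R, μ x < α + μ x := by
  obtain ⟨R, hR, hmin⟩ := Finset.exists_min_image
    ((Q \ A).powerset.filter fun R => α ≤ ∑ x ∈ A, μ x + ∑ x ∈ R, μ x) Finset.card
    ⟨Q \ A, by
      simp only [Finset.mem_filter, Finset.mem_powerset, subset_refl, true_and]
      rw [add_comm, ← Finset.sum_union Finset.sdiff_disjoint]
      refine hQ.trans (Finset.sum_le_sum_of_subset_of_nonneg ?_ fun x _ _ => hμ x)
      intro x hx
      by_cases h : x ∈ A <;> simp [h, hx]⟩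
  simp only [Finset.mem_filter, Finset.mem_powerset] at hR hmin
  refine ⟨R, hR.1.trans Finset.sdiff_subset, ?_, hR.2, ?_⟩
  · rw [Finset.disjoint_left]
    intro x hx hx'
    exact (Finset.mem_sdiff.1 (hR.1 hx')).2 hx
  · intro x hx
    by_contra! hc
    have hsum := Finset.add_sum_erase R μ hx
    have := hmin (R.erase x) ⟨(Finset.erase_subset _ _).trans hR.1, by linarith⟩
    exact absurd (Finset.card_erase_lt_of_mem hx) (not_lt.2 this)

open Classical in
/-- A set of mass above `c` contains a subset of mass at most `c` which exceeds `c - a`, if all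
its elements have mass at most `a`. -/
theorem exists_subset_sum_near {X : Type*} (μ : X → ℝ) (A : Finset X) (a c : ℝ)
    (ha : ∀ x ∈ A, μ x ≤ a) (hc : 0 ≤ c) (hA : c < ∑ x ∈ A, μ x) :
    ∃ R ⊆ A, c - a < ∑ x ∈ R, μ x ∧ ∑ x ∈ R, μ x ≤ c := by
  obtain ⟨R, hR, hmax⟩ := Finset.exists_max_image
    (A.powerset.filter fun R => ∑ x ∈ R, μ x ≤ c) Finset.card ⟨∅, by simpa using hc⟩
  simp only [Finset.mem_filter, Finset.mem_powerset] at hR hmax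
  refine ⟨R, hR.1, ?_, hR.2⟩
  have hne : ∃ x ∈ A, x ∉ R := by
    by_contra! h
    have : R = A := Finset.Subset.antisymm hR.1 h
    rw [this] at hR
    linarith [hR.2]
  obtain ⟨x, hx, hxR⟩ := hne
  by_contra! h
  have hle := hmax (insert x R) ⟨Finset.insert_subset hx hR.1, by
    rw [Finset.sum_insert hxR]
    linarith [ha x hx]⟩
  rw [Finset.card_insert_of_notMem hxR] at hle
  omega

theorem sum_filter_mem_eq {X Z : Type*} [DecidableEq Z] (μ : X → ℝ) (g : X → Z) (A : Finset X)
    (V : Finset Z) :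
    ∑ x ∈ A.filter (fun x => g x ∈ V), μ x
      = ∑ v ∈ V, ∑ x ∈ A.filter (fun x => g x = v), μ x := by
  simp only [Finset.sum_filter]
  rw [Finset.sum_comm]
  refine Finset.sum_congr rfl fun x _ => ?_
  rw [Finset.sum_ite_eq]

open Classical in
/-- Columns outside `Y₀` gain at most `G` over the base rate `β` per value, columns in `Y₀` gain
at most their full mass. -/
theorem sum_gain_le {X Y Z : Type*} [Fintype Y] [DecidableEq Z]
    (μx : X → ℝ) (μy : Y → ℝ) (hμx0 : ∀ x, 0 ≤ μx x) (hμy0 : ∀ y, 0 ≤ μy y)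
    (hμy1 : ∑ y, μy y = 1) (f : X → Y → Z) (A : Finset X) (V : Y → Finset Z) (M : ℕ)
    (hV : ∀ y, (V y).card ≤ M) (Y₀ : Finset Y) (β η L G : ℝ) (hβ0 : 0 ≤ β) (hβ1 : β ≤ 1)
    (hG0 : 0 ≤ G) (hY₀ : ∑ y ∈ Y₀, μy y ≤ η)
    (hL : ∀ y ∉ Y₀, ∀ v, ∑ x ∈ A.filter (fun x => f x y = v), μx x ≤ L)
    (hG : ∀ k : ℕ, 1 ≤ k → k ≤ M → ∀ s, s ≤ ∑ x ∈ A, μx x → s ≤ k * L →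
      s - β * k * ∑ x ∈ A, μx x ≤ G) :
    ∑ y, μy y * (∑ x ∈ A.filter (fun x => f x y ∈ V y), μx x
      - β * (V y).card * ∑ x ∈ A, μx x) ≤ G + (1 - β) * η * ∑ x ∈ A, μx x := by
  set w := ∑ x ∈ A, μx x with hw
  have hw0 : 0 ≤ w := Finset.sum_nonneg fun x _ => hμx0 x
  have hterm : ∀ y, μy y * (∑ x ∈ A.filter (fun x => f x y ∈ V y), μx x
      - β * (V y).card * w) ≤ G * μy y + (1 - β) * w * (if y ∈ Y₀ then μy y else 0) := by
    intro y
    set s := ∑ x ∈ A.filter (fun x => f x y ∈ V y), μx x with hs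
    have hsw : s ≤ w :=
      Finset.sum_le_sum_of_subset_of_nonneg (Finset.filter_subset _ _) fun x _ _ => hμx0 x
    have hβw : 0 ≤ (1 - β) * w := mul_nonneg (by linarith) hw0
    have hy0 := hμy0 y
    rcases Nat.eq_zero_or_pos (V y).card with hk | hk
    · have hs0 : s = 0 := by
        rw [hs, Finset.card_eq_zero.1 hk]
        simp
      rw [hs0, hk]
      simp only [CharP.cast_eq_zero, mul_zero, zero_mul, sub_zero]
      split_ifs <;> positivity
    · split_ifs with hy
      · have h1 : (1 : ℝ) ≤ (V y).card := by exact_mod_cast hk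
        have : s - β * (V y).card * w ≤ G + (1 - β) * w := by
          have := mul_le_mul_of_nonneg_left h1 (mul_nonneg hβ0 hw0)
          nlinarith
        calc _ ≤ μy y * (G + (1 - β) * w) := by gcongr
          _ = _ := by ring
      · have h2 : s ≤ (V y).card * L := by
          rw [hs, sum_filter_mem_eq]
          refine (Finset.sum_le_card_nsmul _ _ L fun v _ => hL y hy v).trans ?_
          simp
        calc _ ≤ μy y * G := by
              gcongr
              exact hG _ hk (hV y) s hsw h2
          _ = _ := by ring
  refine (Finset.sum_le_sum fun y _ => hterm y).trans ?_
  rw [Finset.sum_add_distrib, ← Finset.mul_sum, ← Finset.mul_sum, hμy1, Finset.sum_ite_mem,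
    Finset.univ_inter]
  have : (1 - β) * w * ∑ y ∈ Y₀, μy y ≤ (1 - β) * w * η :=
    mul_le_mul_of_nonneg_left hY₀ (mul_nonneg (by linarith) hw0)
  linarith

open Classical in
/-- Summing the gains of all cells `A τ ∩ P` bounds the total mass of covered entries. -/
theorem covered_mass_le {X Y Z ι : Type*} [Fintype X] [Fintype Y] [DecidableEq Z]
    (μx : X → ℝ) (μy : Y → ℝ) (hμx0 : ∀ x, 0 ≤ μx x) (hμy0 : ∀ y, 0 ≤ μy y)
    (hμx1 : ∑ x, μx x = 1) (hμy1 : ∑ y, μy y = 1) (f : X → Y → Z)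
    (T : Finset ι) (A : ι → Finset X) (V : ι → Y → Finset Z) (M B : ℕ)
    (hM : ∀ x y, ∑ τ ∈ T.filter (fun τ => x ∈ A τ), (V τ y).card ≤ M)
    (hB : ∀ x, (T.filter fun τ => x ∈ A τ).card ≤ B)
    (P : Finset X) (β η G : ℝ) (hβ0 : 0 ≤ β) (hβ1 : β ≤ 1) (hη : 0 ≤ η)
    (hgain : ∀ τ ∈ T, ∑ y, μy y * (∑ x ∈ (A τ ∩ P).filter (fun x => f x y ∈ V τ y), μx x
      - β * (V τ y).card * ∑ x ∈ A τ ∩ P, μx x) ≤ G + (1 - β) * η * ∑ x ∈ A τ ∩ P, μx x) :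
    ∑ x, ∑ y, (if ∃ τ ∈ T, x ∈ A τ ∧ f x y ∈ V τ y then μx x * μy y else 0)
      ≤ ∑ x ∈ Pᶜ, μx x + β * M + T.card * G + (1 - β) * η * B := by
  have hP1 : ∑ x ∈ P, μx x ≤ 1 := by
    rw [← hμx1]
    exact Finset.sum_le_sum_of_subset_of_nonneg (Finset.subset_univ _) fun x _ _ => hμx0 x
  have hsplit : ∑ x, ∑ y, (if ∃ τ ∈ T, x ∈ A τ ∧ f x y ∈ V τ y then μx x * μy y else 0)
      ≤ ∑ x ∈ Pᶜ, μx x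
        + ∑ τ ∈ T, ∑ y, μy y * ∑ x ∈ (A τ ∩ P).filter (fun x => f x y ∈ V τ y), μx x := by
    rw [← Finset.sum_compl_add_sum P]
    refine add_le_add ?_ ?_
    · refine Finset.sum_le_sum fun x _ => ?_
      calc _ ≤ ∑ y, μx x * μy y := by
            refine Finset.sum_le_sum fun y _ => ?_
            split_ifs
            · exact le_rfl
            · exact mul_nonneg (hμx0 x) (hμy0 y)
        _ = μx x := by rw [← Finset.mul_sum, hμy1, mul_one]
    · have hrw : ∀ τ ∈ T, ∑ y, μy y * ∑ x ∈ (A τ ∩ P).filter (fun x => f x y ∈ V τ y), μx x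
          = ∑ x ∈ P, ∑ y, (if x ∈ A τ ∧ f x y ∈ V τ y then μx x * μy y else 0) := by
        intro τ _
        rw [Finset.sum_comm]
        refine Finset.sum_congr rfl fun y _ => ?_
        rw [Finset.mul_sum, ← Finset.sum_filter]
        refine Finset.sum_congr ?_ fun x _ => mul_comm _ _
        ext x
        simp only [Finset.mem_filter, Finset.mem_inter]
        tauto
      rw [Finset.sum_congr rfl hrw, Finset.sum_comm (s := T)]
      refine Finset.sum_le_sum fun x _ => ?_
      rw [Finset.sum_comm]
      refine Finset.sum_le_sum fun y _ => ?_
      have hxy := mul_nonneg (hμx0 x) (hμy0 y)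
      have hnn : ∀ τ ∈ T, 0 ≤ (if x ∈ A τ ∧ f x y ∈ V τ y then μx x * μy y else 0) := by
        intro τ _
        split_ifs <;> simp [hxy]
      split_ifs with h
      · obtain ⟨τ, hτ, h⟩ := h
        have := Finset.single_le_sum hnn hτ
        rwa [if_pos h] at this
      · exact Finset.sum_nonneg hnn
  have hweights : ∀ c : ι → ℝ, ∑ τ ∈ T, c τ * ∑ x ∈ A τ ∩ P, μx x
      = ∑ x ∈ P, μx x * ∑ τ ∈ T.filter (fun τ => x ∈ A τ), c τ := by
    intro c
    simp only [Finset.mul_sum, Finset.sum_filter]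
    rw [Finset.sum_comm]
    refine Finset.sum_congr rfl fun τ _ => ?_
    rw [Finset.inter_comm, ← Finset.filter_mem_eq_inter, Finset.sum_filter]
    refine Finset.sum_congr rfl fun x _ => ?_
    split_ifs <;> ring
  have hbound : ∀ (c : ι → ℝ) (K : ℝ), 0 ≤ K →
      (∀ x, ∑ τ ∈ T.filter (fun τ => x ∈ A τ), c τ ≤ K) →
      ∑ τ ∈ T, c τ * ∑ x ∈ A τ ∩ P, μx x ≤ K := by
    intro c K hK hc
    rw [hweights]
    calc _ ≤ ∑ x ∈ P, μx x * K :=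
          Finset.sum_le_sum fun x _ => mul_le_mul_of_nonneg_left (hc x) (hμx0 x)
      _ = (∑ x ∈ P, μx x) * K := by rw [Finset.sum_mul]
      _ ≤ 1 * K := by gcongr
      _ = K := one_mul K
  have hbase : ∑ τ ∈ T, ∑ y, μy y * (β * (V τ y).card * ∑ x ∈ A τ ∩ P, μx x) ≤ β * M := by
    rw [Finset.sum_comm]
    calc _ = ∑ y, μy y * (β * ∑ τ ∈ T, ((V τ y).card : ℝ) * ∑ x ∈ A τ ∩ P, μx x) := by
          refine Finset.sum_congr rfl fun y _ => ?_
          rw [Finset.mul_sum, Finset.mul_sum]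
          refine Finset.sum_congr rfl fun τ _ => ?_
          ring
      _ ≤ ∑ y, μy y * (β * M) := by
          refine Finset.sum_le_sum fun y _ => mul_le_mul_of_nonneg_left
            (mul_le_mul_of_nonneg_left ?_ hβ0) (hμy0 y)
          refine hbound _ _ (Nat.cast_nonneg _) fun x => ?_
          exact_mod_cast hM x y
      _ = β * M := by rw [← Finset.sum_mul, hμy1, one_mul]
  have hheavy : ∑ τ ∈ T, (1 : ℝ) * ∑ x ∈ A τ ∩ P, μx x ≤ B := by
    refine hbound _ _ (Nat.cast_nonneg _) fun x => ?_
    simpa using hB x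
  have htotal := Finset.sum_le_sum hgain
  simp only [mul_sub, Finset.sum_sub_distrib, Finset.sum_add_distrib, Finset.sum_const,
    nsmul_eq_mul, ← Finset.mul_sum] at htotal
  simp only [one_mul] at hheavy
  have := mul_le_mul_of_nonneg_left hheavy (mul_nonneg (sub_nonneg.2 hβ1) hη)
  linarith

open Classical in
/-- The columns in which some value takes up at least a `θ`-fraction of `S`. -/
noncomputable def richColumns {X Y Z : Type*} [Fintype Y] [DecidableEq Z] (μ : X → ℝ)
    (f : X → Y → Z) (θ : ℝ) (S : Finset X) : Finset Y :=
  Finset.univ.filter fun y =>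
    ∃ v, θ * ∑ x ∈ S, μ x ≤ ∑ x ∈ S.filter (fun x => f x y = v), μ x

theorem lt_of_notMem_richColumns {X Y Z : Type*} [Fintype Y] [DecidableEq Z] {μ : X → ℝ}
    {f : X → Y → Z} {θ : ℝ} {S : Finset X} {y : Y} (hy : y ∉ richColumns μ f θ S) (v : Z) :
    ∑ x ∈ S.filter (fun x => f x y = v), μ x < θ * ∑ x ∈ S, μ x := by
  by_contra! h
  exact hy (by simpa [richColumns] using ⟨v, h⟩)

theorem lt_of_sum_richColumns_lt {X Y Z : Type*} [Fintype Y] [DecidableEq Z] {μ : X → ℝ}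
    {μy : Y → ℝ} (hμ : ∀ x, 0 ≤ μ x) (hμy1 : ∑ y, μy y = 1) {f : X → Y → Z} {θ : ℝ}
    {S : Finset X} (hS : ∑ y ∈ richColumns μ f θ S, μy y < 1) {x : X} (hx : x ∈ S) :
    μ x < θ * ∑ x ∈ S, μ x := by
  by_contra! h
  have huniv : richColumns μ f θ S = Finset.univ := by
    refine Finset.eq_univ_of_forall fun y => ?_
    by_contra hy
    have h1 := lt_of_notMem_richColumns hy (f x y)
    have h2 := Finset.single_le_sum (f := μ) (fun i _ => hμ i)
      (show x ∈ S.filter (fun x' => f x' y = f x y) by simp [hx])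
    linarith
  rw [huniv, hμy1] at hS
  exact lt_irrefl _ hS

open Classical in
/-- The gain of a set which can be filled up to a set `S` without losing much. -/
theorem sum_gain_le_of_superset {X Y Z : Type*} [Fintype Y] [DecidableEq Z]
    (μx : X → ℝ) (μy : Y → ℝ) (hμx0 : ∀ x, 0 ≤ μx x) (hμy0 : ∀ y, 0 ≤ μy y)
    (hμy1 : ∑ y, μy y = 1) (f : X → Y → Z) (A S : Finset X) (hAS : A ⊆ S) (V : Y → Finset Z)
    (M : ℕ) (hV : ∀ y, (V y).card ≤ M) (η θ G : ℝ) (hθ0 : 0 ≤ θ) (hθ1 : θ ≤ 1) (hG0 : 0 ≤ G)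
    (hS : ∑ y ∈ richColumns μx f θ S, μy y ≤ η)
    (hG : ∀ k : ℕ, 1 ≤ k → k ≤ M → ∀ s, s ≤ ∑ x ∈ A, μx x → s ≤ k * (θ * ∑ x ∈ S, μx x) →
      s - θ * k * ∑ x ∈ A, μx x ≤ G) :
    ∑ y, μy y * (∑ x ∈ A.filter (fun x => f x y ∈ V y), μx x
      - θ * (V y).card * ∑ x ∈ A, μx x) ≤ G + (1 - θ) * η * ∑ x ∈ A, μx x := by
  refine sum_gain_le μx μy hμx0 hμy0 hμy1 f A V M hV _ θ η (θ * ∑ x ∈ S, μx x) G hθ0 hθ1 hG0 hS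
    (fun y hy v => ?_) hG
  refine le_trans ?_ (lt_of_notMem_richColumns hy v).le
  exact Finset.sum_le_sum_of_subset_of_nonneg (Finset.filter_subset_filter _ hAS)
    fun x _ _ => hμx0 x

open Classical in
/-- If two elements of `A` always make up a `θ`-fraction of `S ⊇ A`, then a column outside
`richColumns` has at most one element of `A` per value. -/
theorem sum_gain_le_of_pairs {X Y Z : Type*} [Fintype Y] [DecidableEq Z]
    (μx : X → ℝ) (μy : Y → ℝ) (hμx0 : ∀ x, 0 ≤ μx x) (hμy0 : ∀ y, 0 ≤ μy y)
    (hμy1 : ∑ y, μy y = 1) (f : X → Y → Z) (A S : Finset X) (hAS : A ⊆ S) (V : Y → Finset Z)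
    (M : ℕ) (hV : ∀ y, (V y).card ≤ M) (β η θ a G : ℝ) (hβ0 : 0 ≤ β) (hβ1 : β ≤ 1) (hG0 : 0 ≤ G)
    (hS : ∑ y ∈ richColumns μx f θ S, μy y ≤ η) (ha0 : 0 ≤ a) (ha : ∀ x ∈ A, μx x ≤ a)
    (hpair : ∀ x ∈ A, θ * ∑ x ∈ S, μx x ≤ 2 * μx x)
    (hG : ∀ k : ℕ, 1 ≤ k → k ≤ M → ∀ s, s ≤ ∑ x ∈ A, μx x → s ≤ k * a →
      s - β * k * ∑ x ∈ A, μx x ≤ G) :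
    ∑ y, μy y * (∑ x ∈ A.filter (fun x => f x y ∈ V y), μx x
      - β * (V y).card * ∑ x ∈ A, μx x) ≤ G + (1 - β) * η * ∑ x ∈ A, μx x := by
  refine sum_gain_le μx μy hμx0 hμy0 hμy1 f A V M hV _ β η a G hβ0 hβ1 hG0 hS
    (fun y hy v => ?_) hG
  have hcard : (A.filter fun x => f x y = v).card ≤ 1 := by
    rw [Finset.card_le_one]
    intro x hx x' hx'
    by_contra hne
    rw [Finset.mem_filter] at hx hx'
    have h1 := lt_of_notMem_richColumns hy v
    have h2 : ∑ i ∈ ({x, x'} : Finset X), μx i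
        ≤ ∑ i ∈ S.filter (fun i => f i y = v), μx i := by
      refine Finset.sum_le_sum_of_subset_of_nonneg ?_ fun i _ _ => hμx0 i
      intro i hi
      simp only [Finset.mem_insert, Finset.mem_singleton] at hi
      rcases hi with rfl | rfl
      · exact Finset.mem_filter.2 ⟨hAS hx.1, hx.2⟩
      · exact Finset.mem_filter.2 ⟨hAS hx'.1, hx'.2⟩
    rw [Finset.sum_pair hne] at h2
    linarith [hpair x hx.1, hpair x' hx'.1]
  refine (Finset.sum_le_card_nsmul _ _ a fun x hx => ha x (Finset.mem_filter.1 hx).1).trans ?_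
  rw [nsmul_eq_mul]
  have : ((A.filter fun x => f x y = v).card : ℝ) ≤ 1 := by exact_mod_cast hcard
  nlinarith

open Classical in
/-- The gain of a set of elements of mass between `θ * α` and `θ * α / (1 - θ)`. -/
theorem sum_gain_le_of_large_elements {X Y Z : Type*} [Fintype X] [Fintype Y] [DecidableEq Z]
    (μx : X → ℝ) (μy : Y → ℝ) (hμx0 : ∀ x, 0 ≤ μx x) (hμy0 : ∀ y, 0 ≤ μy y)
    (hμx1 : ∑ x, μx x = 1) (hμy1 : ∑ y, μy y = 1) (f : X → Y → Z) (V : Y → Finset Z)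
    (M : ℕ) (hV : ∀ y, (V y).card ≤ M) (α η θ : ℝ) (hα0 : 0 < α) (hα1 : α ≤ 1) (hθ0 : 0 < θ)
    (hθ1 : θ ≤ 1 / 4)
    (hrich : ∀ S : Finset X, α ≤ ∑ x ∈ S, μx x → ∑ y ∈ richColumns μx f θ S, μy y ≤ η)
    (hsmall : ∀ x, (1 - θ) * μx x ≤ θ * α) (A : Finset X) (hlarge : ∀ x ∈ A, θ * α < μx x) :
    ∑ y, μy y * (∑ x ∈ A.filter (fun x => f x y ∈ V y), μx x
      - θ / (2 - 3 * θ) * (V y).card * ∑ x ∈ A, μx x)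
      ≤ α / 2 + (1 - θ / (2 - 3 * θ)) * η * ∑ x ∈ A, μx x := by
  have hβ0 : 0 ≤ θ / (2 - 3 * θ) := div_nonneg hθ0.le (by linarith)
  have hβ1 : θ / (2 - 3 * θ) ≤ 1 := by
    rw [div_le_one (by linarith)]
    linarith
  set β := θ / (2 - 3 * θ) with hβ
  set a := θ * α / (1 - θ) with ha
  have ha0 : 0 < a := div_pos (mul_pos hθ0 hα0) (by linarith)
  have hle_a : ∀ x, μx x ≤ a := by
    intro x
    rw [ha, le_div_iff₀ (by linarith)]
    linarith [hsmall x]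
  have ha_le : a ≤ α / 3 := by
    rw [ha, div_le_iff₀ (by linarith)]
    nlinarith
  have hβa : β * (2 * α - a) = a := by
    have h1 : (2 - 3 * θ) ≠ 0 := by linarith
    have h2 : (1 - θ) ≠ 0 := by linarith
    have h3 : 2 * α - a = (2 - 3 * θ) * (α / (1 - θ)) := by
      rw [ha]
      field_simp
      ring
    rw [h3, hβ, ← mul_assoc, div_mul_cancel₀ _ h1, ha, mul_div_assoc]
  have ha4 : a ≤ 2 * β * α := by nlinarith
  induction A using Finset.strongInduction with
  | H A ih =>
  rcases le_or_gt (∑ x ∈ A, μx x) (2 * α) with hA | hA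
  · obtain ⟨S, hAS, hαS, hS2⟩ : ∃ S, A ⊆ S ∧ α ≤ ∑ x ∈ S, μx x ∧ ∑ x ∈ S, μx x ≤ 2 * α := by
      rcases le_or_gt α (∑ x ∈ A, μx x) with h | h
      · exact ⟨A, subset_rfl, h, hA⟩
      · obtain ⟨R, -, hdisj, hR1, hR2⟩ := exists_minimal_filler μx hμx0 A Finset.univ α
          (by rw [hμx1]; exact hα1)
        refine ⟨A ∪ R, Finset.subset_union_left, ?_, ?_⟩
        · rwa [Finset.sum_union hdisj]
        · rw [Finset.sum_union hdisj]
          rcases R.eq_empty_or_nonempty with rfl | ⟨x, hx⟩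
          · simp only [Finset.sum_empty] at hR1
            linarith
          · linarith [hR2 x hx, hle_a x]
    refine sum_gain_le_of_pairs μx μy hμx0 hμy0 hμy1 f A S hAS V M hV β η θ a (α / 2) hβ0 hβ1
      (by linarith) (hrich S hαS) ha0.le (fun x _ => hle_a x) (fun x hx => ?_) ?_
    · nlinarith [hlarge x hx]
    · intro k _ _ s hs hsk
      set w := ∑ x ∈ A, μx x
      have hw0 : 0 ≤ w := Finset.sum_nonneg fun x _ => hμx0 x
      have hk0 : (0 : ℝ) ≤ k := Nat.cast_nonneg k
      have hβk : 0 ≤ β * k := mul_nonneg hβ0 hk0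
      rcases le_or_gt 1 (β * k) with h1 | h1
      · nlinarith
      · have h2 : s - β * k * w ≤ (1 - β * k) * (k * a) := by nlinarith
        have h3 : (1 - β * k) * (k * a) ≤ (1 - β * k) * (k * (2 * β * α)) := by
          gcongr
        nlinarith [mul_nonneg hα0.le (sq_nonneg (2 * (β * k) - 1))]
  · obtain ⟨R, hRA, hR1, hR2⟩ := exists_subset_sum_near μx A a (2 * α) (fun x _ => hle_a x)
      (by linarith) hA
    have hRne : R.Nonempty := by
      rw [Finset.nonempty_iff_ne_empty]
      rintro rfl
      simp only [Finset.sum_empty] at hR1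
      linarith
    have hgainR := sum_gain_le_of_pairs μx μy hμx0 hμy0 hμy1 f R R subset_rfl V M hV β η θ a 0
      hβ0 hβ1 le_rfl (hrich R (by linarith)) ha0.le (fun x _ => hle_a x)
      (fun x hx => by nlinarith [hlarge x (hRA hx)])
      (fun k _ _ s _ hsk => by
        have hk0 : (0 : ℝ) ≤ k := Nat.cast_nonneg k
        have : a ≤ β * ∑ x ∈ R, μx x := by
          rw [← hβa]
          gcongr
        nlinarith)
    have hrest := ih (A \ R) (Finset.sdiff_ssubset hRA hRne)
      fun x hx => hlarge x (Finset.sdiff_subset hx)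
    have hsum := Finset.sum_sdiff (f := μx) hRA
    have hfilter : ∀ y, ∑ x ∈ A.filter (fun x => f x y ∈ V y), μx x
        = ∑ x ∈ (A \ R).filter (fun x => f x y ∈ V y), μx x
          + ∑ x ∈ R.filter (fun x => f x y ∈ V y), μx x := by
      intro y
      simp only [Finset.sum_filter]
      exact (Finset.sum_sdiff hRA).symm
    calc _ = ∑ y, μy y * (∑ x ∈ (A \ R).filter (fun x => f x y ∈ V y), μx x
            - β * (V y).card * ∑ x ∈ A \ R, μx x)
          + ∑ y, μy y * (∑ x ∈ R.filter (fun x => f x y ∈ V y), μx x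
            - β * (V y).card * ∑ x ∈ R, μx x) := by
          rw [← Finset.sum_add_distrib]
          refine Finset.sum_congr rfl fun y _ => ?_
          rw [hfilter, ← hsum]
          ring
      _ ≤ _ := by
          rw [← hsum]
          linarith

open Classical in
/-- The gain of an arbitrary set, if fillers with elements of mass at most `θ * α` exist. -/
theorem sum_gain_le_of_small_elements {X Y Z : Type*} [Fintype Y] [DecidableEq Z]
    (μx : X → ℝ) (μy : Y → ℝ) (hμx0 : ∀ x, 0 ≤ μx x) (hμy0 : ∀ y, 0 ≤ μy y)
    (hμy1 : ∑ y, μy y = 1) (f : X → Y → Z) (V : Y → Finset Z)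
    (M : ℕ) (hV : ∀ y, (V y).card ≤ M) (α η θ : ℝ) (hα0 : 0 < α) (hθ0 : 0 < θ)
    (hθ1 : θ ≤ 1)
    (hrich : ∀ S : Finset X, α ≤ ∑ x ∈ S, μx x → ∑ y ∈ richColumns μx f θ S, μy y ≤ η)
    (A Q : Finset X) (hQ : α ≤ ∑ x ∈ Q, μx x)
    (hsmall : (∀ x ∈ Q, μx x ≤ θ * α) ∨ (M = 1 ∧ ∀ x ∈ Q, μx x ≤ α / 2)) :
    ∑ y, μy y * (∑ x ∈ A.filter (fun x => f x y ∈ V y), μx x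
      - θ * (V y).card * ∑ x ∈ A, μx x)
      ≤ α * (1 + θ) / 4 + (1 - θ) * η * ∑ x ∈ A, μx x := by
  have hG0 : 0 ≤ α * (1 + θ) / 4 := by positivity
  rcases le_or_gt α (∑ x ∈ A, μx x) with h | h
  · refine sum_gain_le_of_superset μx μy hμx0 hμy0 hμy1 f A A subset_rfl V M hV η θ _ hθ0.le hθ1
      hG0 (hrich A h) fun k _ _ s _ hs => ?_
    linarith
  obtain ⟨R, hRQ, hdisj, hR1, hR2⟩ := exists_minimal_filler μx hμx0 A Q α hQ
  have hS : ∑ x ∈ A ∪ R, μx x = ∑ x ∈ A, μx x + ∑ x ∈ R, μx x := Finset.sum_union hdisj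
  refine sum_gain_le_of_superset μx μy hμx0 hμy0 hμy1 f A (A ∪ R) Finset.subset_union_left V M hV
    η θ _ hθ0.le hθ1 hG0 (hrich _ (hS ▸ hR1)) fun k hk1 hkM s hsw hs => ?_
  rw [hS] at hs
  set w := ∑ x ∈ A, μx x
  set r := ∑ x ∈ R, μx x with hr
  have hw0 : 0 ≤ w := Finset.sum_nonneg fun x _ => hμx0 x
  obtain ⟨x, hx⟩ : R.Nonempty := by
    rw [Finset.nonempty_iff_ne_empty]
    rintro rfl
    simp only [Finset.sum_empty] at hr
    linarith
  rcases hsmall with hsmall | ⟨hM1, hsmall⟩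
  · have hF : w + r ≤ α * (1 + θ) := by linarith [hR2 x hx, hsmall x (hRQ hx)]
    set ρ := θ * k with hρ
    have hρ0 : 0 ≤ ρ := by positivity
    rcases le_or_gt 1 ρ with h1 | h1
    · nlinarith
    · have h2 : s - ρ * w ≤ (1 - ρ) * ρ * (w + r) := by
        have : s ≤ ρ * (w + r) := by rw [hρ]; linarith
        nlinarith
      have h3 : (1 - ρ) * ρ * (w + r) ≤ (1 - ρ) * ρ * (α * (1 + θ)) :=
        mul_le_mul_of_nonneg_left hF (mul_nonneg (by linarith) hρ0)
      have h4 : 0 ≤ α * (1 + θ) := by positivity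
      nlinarith [mul_nonneg h4 (sq_nonneg (2 * ρ - 1))]
  · obtain rfl : k = 1 := by omega
    simp only [Nat.cast_one, mul_one, one_mul] at hs ⊢
    have hcases : r ≤ α / 2 ∨ r ≤ 2 * (α - w) := by
      by_cases hone : ∃ x' ∈ R, x' ≠ x
      · right
        obtain ⟨x', hx', hne⟩ := hone
        have h2 : ∑ i ∈ ({x, x'} : Finset X), μx i ≤ r :=
          Finset.sum_le_sum_of_subset_of_nonneg (by
            intro i hi
            simp only [Finset.mem_insert, Finset.mem_singleton] at hi
            rcases hi with rfl | rfl
            · exact hx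
            · exact hx') fun i _ _ => hμx0 i
        rw [Finset.sum_pair (Ne.symm hne)] at h2
        linarith [hR2 x hx, hR2 x' hx']
      · left
        push Not at hone
        have : R = {x} := Finset.eq_singleton_iff_unique_mem.2 ⟨hx, hone⟩
        rw [hr, this, Finset.sum_singleton]
        exact hsmall x (hRQ hx)
    rcases hcases with h1 | h1
    · nlinarith
    · have hp : s - θ * w ≤ (1 - θ) * w := by linarith
      have hq : s - θ * w ≤ 2 * θ * (α - w) := by nlinarith
      have hcomb : (1 + θ) * (s - θ * w) ≤ 2 * θ * (1 - θ) * α := by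
        nlinarith [mul_le_mul_of_nonneg_left hp hθ0.le,
          mul_le_mul_of_nonneg_left hq (sub_nonneg.2 hθ1)]
      have hsq : 2 * θ * (1 - θ) * α ≤ (1 + θ) * (α * (1 + θ) / 4) := by
        nlinarith [mul_nonneg hα0.le (sq_nonneg (3 * θ - 1))]
      exact le_of_mul_le_mul_left (hcomb.trans hsq) (by linarith)

set_option maxHeartbeats 400000 in
open Classical in
/-- If the parts `A τ` and value sets `V τ y` cover a `δ`-fraction of all entries, then there is a
large rectangle in which every column is rich in some value. -/
theorem exists_rectangle_of_cover {X Y Z ι : Type*} [Fintype X] [Fintype Y] [DecidableEq Z]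
    (μx : X → ℝ) (μy : Y → ℝ) (hμx0 : ∀ x, 0 ≤ μx x) (hμy0 : ∀ y, 0 ≤ μy y)
    (hμx1 : ∑ x, μx x = 1) (hμy1 : ∑ y, μy y = 1) (f : X → Y → Z)
    (T : Finset ι) (A : ι → Finset X) (V : ι → Y → Finset Z) (a b D : ℕ)
    (ha : 1 ≤ a) (hb : 1 ≤ b) (hD : 1 ≤ D)
    (hM : ∀ x y, ∑ τ ∈ T.filter (fun τ => x ∈ A τ), (V τ y).card ≤ 2 * D - 1)
    (hV : ∀ τ y, (V τ y).card ≤ 2 * D - 1)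
    (hB : ∀ x, (T.filter fun τ => x ∈ A τ).card ≤ b)
    (hT : T.card + 2 * a + 2 * b ≤ 4 * (a * b) + 1) (δ : ℝ) (hδ : 0 < δ)
    (hcover : δ ≤ ∑ x, ∑ y, (if ∃ τ ∈ T, x ∈ A τ ∧ f x y ∈ V τ y then μx x * μy y else 0)) :
    ∃ S : Finset X, δ / (4 * (a * b * D)) ≤ ∑ x ∈ S, μx x ∧
      δ / (4 * (b * D)) ≤ ∑ y ∈ richColumns μx f (δ / (2 * D)) S, μy y := by
  by_contra! hno
  have hδ1 : δ ≤ 1 := by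
    refine hcover.trans ?_
    calc _ ≤ ∑ x, ∑ y, μx x * μy y := by
          refine Finset.sum_le_sum fun x _ => Finset.sum_le_sum fun y _ => ?_
          split_ifs
          · exact le_rfl
          · exact mul_nonneg (hμx0 x) (hμy0 y)
      _ = 1 := by simp only [← Finset.mul_sum, hμy1, mul_one, hμx1]
  have ha' : (1 : ℝ) ≤ a := by exact_mod_cast ha
  have hb' : (1 : ℝ) ≤ b := by exact_mod_cast hb
  have hD' : (1 : ℝ) ≤ D := by exact_mod_cast hD
  have hab : (1 : ℝ) ≤ a * b := by nlinarith
  set θ := δ / (2 * D) with hθ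
  set η := δ / (4 * (b * D)) with hη
  set α := δ / (4 * (a * b * D)) with hα
  have hθ0 : 0 < θ := by positivity
  have hη0 : 0 < η := by positivity
  have hα0 : 0 < α := by positivity
  have hθδ : θ * (2 * D) = δ := by rw [hθ]; field_simp
  have hηb : η * b = θ / 2 := by rw [hη, hθ]; field_simp; norm_num
  have hαab : α * (a * b) = θ / 2 := by rw [hα, hθ]; field_simp; norm_num
  have hθD : θ * D ≤ 1 / 2 := by linarith
  have hθ2 : θ ≤ 1 / 2 := by nlinarith
  have hα2 : α ≤ 1 / 4 := by nlinarith
  have hη2 : η ≤ 1 / 4 := by nlinarith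
  have hTα : (T.card + 3) * α ≤ 2 * θ := by
    have h1 : T.card + 3 ≤ 4 * (a * b) := by omega
    have h2 : (T.card + 3 : ℝ) ≤ 4 * (a * b) := by exact_mod_cast h1
    nlinarith
  have hrich : ∀ S : Finset X, α ≤ ∑ x ∈ S, μx x → ∑ y ∈ richColumns μx f θ S, μy y ≤ η :=
    fun S hS => (hno S hS).le
  have hlt : ∀ S : Finset X, α ≤ ∑ x ∈ S, μx x → ∀ x ∈ S, μx x < θ * ∑ x ∈ S, μx x :=
    fun S hS x hx => lt_of_sum_richColumns_lt hμx0 hμy1 (by linarith [hrich S hS]) hx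
  have hltα : ∀ x, μx x < α := by
    intro x
    by_contra! h
    have := hlt {x} (by simpa using h) x (by simp)
    rw [Finset.sum_singleton] at this
    nlinarith
  have hMcast : ((2 * D - 1 : ℕ) : ℝ) = 2 * D - 1 := by
    rw [Nat.cast_sub (by omega)]
    push_cast
    ring
  have hnofiller : ∀ Q : Finset X, α ≤ ∑ x ∈ Q, μx x →
      ¬ ((∀ x ∈ Q, μx x ≤ θ * α) ∨ (2 * D - 1 = 1 ∧ ∀ x ∈ Q, μx x ≤ α / 2)) := by
    intro Q hQ hsmall
    have := hcover.trans (covered_mass_le μx μy hμx0 hμy0 hμx1 hμy1 f T A V (2 * D - 1) b hM hB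
      Finset.univ θ η (α * (1 + θ) / 4) hθ0.le (by linarith) hη0.le fun τ _ =>
        sum_gain_le_of_small_elements μx μy hμx0 hμy0 hμy1 f (V τ) (2 * D - 1) (hV τ) α η θ hα0
          hθ0 (by linarith) hrich _ Q hQ hsmall)
    rw [Finset.compl_univ, Finset.sum_empty, hMcast] at this
    have h1 := mul_le_mul_of_nonneg_right hTα (by linarith : 0 ≤ 1 + θ)
    have h2 : (1 - θ) * η * b = (1 - θ) * (θ / 2) := by rw [mul_assoc, hηb]
    have h3 := mul_pos hα0 (by linarith : 0 < 1 + θ)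
    linarith
  have hPsum : ∑ x ∈ Finset.univ.filter (fun x => μx x ≤ θ * α), μx x < α := by
    by_contra! h
    exact hnofiller _ h (Or.inl fun x hx => (Finset.mem_filter.1 hx).2)
  obtain ⟨x₁, hx₁⟩ : ∃ x₁, ∀ x, μx x ≤ μx x₁ := by
    have hne : (Finset.univ : Finset X).Nonempty := by
      rw [Finset.nonempty_iff_ne_empty]
      intro h
      rw [h, Finset.sum_empty] at hμx1
      exact zero_ne_one hμx1
    obtain ⟨x₁, -, h⟩ := Finset.exists_max_image Finset.univ μx hne
    exact ⟨x₁, fun x => h x (Finset.mem_univ x)⟩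
  rcases Nat.lt_or_ge 1 D with hD2 | hD1
  · have hD2' : (2 : ℝ) ≤ D := by exact_mod_cast hD2
    have hθ4 : θ ≤ 1 / 4 := by nlinarith
    have hx₁small : (1 - θ) * μx x₁ ≤ θ * α := by
      obtain ⟨R, -, hdisj, hR1, hR2⟩ := exists_minimal_filler μx hμx0 {x₁} Finset.univ α
        (by rw [hμx1]; linarith)
      rw [← Finset.sum_union hdisj] at hR1 hR2
      have h1 := hlt _ hR1 x₁ (by simp)
      rcases R.eq_empty_or_nonempty with rfl | ⟨x, hx⟩
      · rw [Finset.union_empty, Finset.sum_singleton] at h1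
        nlinarith [hμx0 x₁]
      · have h2 := hR2 x hx
        have h3 := hx₁ x
        have h4 := mul_le_mul_of_nonneg_left (h2.le.trans (add_le_add_right h3 α)) hθ0.le
        linarith
    set β := θ / (2 - 3 * θ) with hβ
    have hβ0 : 0 ≤ β := div_nonneg hθ0.le (by linarith)
    have hβ1 : β ≤ 1 := by
      rw [hβ, div_le_one (by linarith)]
      linarith
    have hβbase : β * (2 * D - 1) + 3 * θ / 2 ≤ δ := by
      have h1 : β * (2 * D - 1) ≤ θ * (2 * D - 3 / 2) := by
        rw [hβ, div_mul_eq_mul_div, div_le_iff₀ (by linarith), mul_assoc]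
        refine mul_le_mul_of_nonneg_left ?_ hθ0.le
        rcases Nat.lt_or_ge 2 D with h | h
        · have h' : (3 : ℝ) ≤ D := by exact_mod_cast h
          nlinarith
        · have h' : (D : ℝ) ≤ 2 := by exact_mod_cast h
          nlinarith
      linarith
    have := hcover.trans (covered_mass_le μx μy hμx0 hμy0 hμx1 hμy1 f T A V (2 * D - 1) b hM hB
      (Finset.univ.filter fun x => μx x ≤ θ * α)ᶜ β η (α / 2) hβ0 hβ1 hη0.le fun τ _ =>
        sum_gain_le_of_large_elements μx μy hμx0 hμy0 hμx1 hμy1 f (V τ) (2 * D - 1) (hV τ) α η θ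
          hα0 (by linarith) hθ0 hθ4 hrich
          (fun x => (mul_le_mul_of_nonneg_left (hx₁ x) (by linarith)).trans hx₁small) _ fun x hx => by
            have := (Finset.mem_inter.1 hx).2
            simpa using this)
    rw [compl_compl, hMcast] at this
    have hβη : (1 - β) * η * b ≤ θ / 2 := by
      rw [mul_assoc, hηb]
      nlinarith
    linarith
  · obtain rfl : D = 1 := by omega
    refine hnofiller (Finset.univ.erase x₁) ?_ (Or.inr ⟨rfl, fun x hx => ?_⟩)
    · have := Finset.add_sum_erase Finset.univ μx (Finset.mem_univ x₁)
      linarith [hltα x₁]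
    · by_contra! h
      have hsum := Finset.sum_pair (f := μx) (Finset.ne_of_mem_erase hx).symm
      have h1 := hlt {x₁, x} (by linarith [hx₁ x]) x₁ (by simp)
      nlinarith [hx₁ x]


open Classical Real Finset in
/-- If a valid `4ANC` protocol `δ`-solves `f : X × Y → Z` under a product input
distribution `μ = μx × μy` with communication cost `(c_A, c_B, c_M)`, then the
communication matrix of `f` contains a rectangle `X' × Y'` which is
`(δ/2)·2^{−c_M}`-column-monochromatic with `μx(X') ≥ (δ/4)·2^{−(c_M+c_A+c_B)}`
and `μy(Y') ≥ (δ/4)·2^{−(c_M+c_B)}`.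

The deterministic (randomness fixed) protocol is modelled by: `Mmer` (Merlin's
correct message), `Mmeg` (Megan's correct message given Merlin's message),
`run x y m g = (Alice's bits, Bob's bits)` of the Alice–Bob interaction given
Merlin's message `m` and Megan's message `g`, Bob's proceed/reject decision
`proceed`, and Bob's output `out`. -/
theorem stmt5 {X Y Z : Type} [Fintype X] [Fintype Y] [DecidableEq Z]
    (μx : X → ℝ) (μy : Y → ℝ)
    (hμx0 : ∀ x, 0 ≤ μx x) (hμy0 : ∀ y, 0 ≤ μy y)
    (hμx1 : ∑ x, μx x = 1) (hμy1 : ∑ y, μy y = 1)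
    (f : X → Y → Z) (cA cB cM : ℕ) (δ : ℝ) (hδ : 0 < δ)
    (Mmer : X → Y → List Bool)
    (Mmeg : X → Y → List Bool → List Bool)
    (run : X → Y → List Bool → List Bool → List Bool × List Bool)
    (proceed : Y → List Bool → List Bool → List Bool × List Bool → Bool)
    (out : Y → List Bool → List Bool → List Bool × List Bool → Z)
    -- rectangle property of the deterministic Alice–Bob interaction
    (Hrect : ∀ x x' y y' m m' g g',
      run x y m g = run x' y' m' g' → run x y' m' g' = run x y m g)
    -- Alice's messages depend only on her input and on Bob's transmitted bits
    (HA : ∀ x y y' m m' g g',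
      (run x y m g).2 = (run x y' m' g').2 → (run x y m g).1 = (run x y' m' g').1)
    -- prefix-freeness of Bob's bits for a fixed Alice input
    (Hpf : ∀ x y y' m m' g g',
      (run x y m g).2 <+: (run x y' m' g').2 → (run x y m g).2 = (run x y' m' g').2)
    -- validity: Bob proceeds if and only if Megan's message is the correct one
    (Hvalid : ∀ x y m g,
      proceed y m g (run x y m g) = true ↔ g = Mmeg x y m)
    -- the protocol δ-solves f under μ with communication cost (c_A, c_B, c_M)
    (Hsolve : δ ≤ ∑ x, ∑ y,
      (if (Mmer x y).length ≤ cM ∧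
          (run x y (Mmer x y) (Mmeg x y (Mmer x y))).1.length ≤ cA ∧
          (run x y (Mmer x y) (Mmeg x y (Mmer x y))).2.length ≤ cB ∧
          out y (Mmer x y) (Mmeg x y (Mmer x y))
            (run x y (Mmer x y) (Mmeg x y (Mmer x y))) = f x y
        then μx x * μy y else 0)) :
    ∃ (X' : Finset X) (Y' : Finset Y),
      (∀ y ∈ Y', ∃ v : Z,
        δ / 2 * 2 ^ (-(cM : ℝ)) * ((∑ x ∈ X', μx x) * μy y) ≤
          (∑ x ∈ X'.filter (fun x => f x y = v), μx x) * μy y)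
      ∧ δ / 4 * 2 ^ (-((cM : ℝ) + cA + cB)) ≤ ∑ x ∈ X', μx x
      ∧ δ / 4 * 2 ^ (-((cM : ℝ) + cB)) ≤ ∑ y ∈ Y', μy y := by
  have hrel : ∀ x x' y m (τ : List Bool × List Bool), (∃ y m g, run x y m g = τ) →
      run x' y m (Mmeg x' y m) = τ → Mmeg x' y m = Mmeg x y m ∧ run x y m (Mmeg x y m) = τ := by
    rintro x x' y m τ ⟨y₀, m₀, g₀, h₀⟩ h
    have h1 : run x y m (Mmeg x' y m) = τ :=
      (Hrect x x' y₀ y m₀ m g₀ (Mmeg x' y m) (h₀.trans h.symm)).trans h₀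
    have h2 := (Hvalid x' y m (Mmeg x' y m)).2 rfl
    rw [h, ← h1, Hvalid] at h2
    exact ⟨h2, h2 ▸ h1⟩
  set T := bitStrings cA ×ˢ bitStrings cB with hT
  set A : List Bool × List Bool → Finset X :=
    fun τ => Finset.univ.filter fun x => ∃ y m g, run x y m g = τ with hA
  set V : List Bool × List Bool → Y → Finset Z := fun τ y =>
    ((bitStrings cM ×ˢ (Finset.univ : Finset X)).filter
      fun p => run p.2 y p.1 (Mmeg p.2 y p.1) = τ).image
      fun p => out y p.1 (Mmeg p.2 y p.1) τ with hV
  have hVcard : ∀ x τ y, x ∈ A τ → (V τ y).card ≤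
      ((bitStrings cM).filter fun m => run x y m (Mmeg x y m) = τ).card := by
    intro x τ y hx
    refine le_trans (Finset.card_le_card ?_) (Finset.card_image_le
      (f := fun m => out y m (Mmeg x y m) τ))
    intro v hv
    obtain ⟨⟨m, x'⟩, hp, rfl⟩ := Finset.mem_image.1 hv
    simp only [Finset.mem_filter, Finset.mem_product, Finset.mem_univ, and_true] at hp
    obtain ⟨h1, h2⟩ := hrel x x' y m τ (Finset.mem_filter.1 hx).2 hp.2
    exact Finset.mem_image.2 ⟨m, Finset.mem_filter.2 ⟨hp.1, h2⟩, by simp only [h1]⟩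
  have hmsg : (bitStrings cM).card ≤ 2 * 2 ^ cM - 1 := by
    have := card_bitStrings_lt cM
    omega
  obtain ⟨S, hS1, hS2⟩ := exists_rectangle_of_cover μx μy hμx0 hμy0 hμx1 hμy1 f T A V
    (2 ^ cA) (2 ^ cB) (2 ^ cM) Nat.one_le_two_pow Nat.one_le_two_pow Nat.one_le_two_pow
    (by
      intro x y
      refine le_trans (Finset.sum_le_sum fun τ hτ =>
        hVcard x τ y (Finset.mem_filter.1 hτ).2) ?_
      rw [Finset.sum_card_fiberwise_eq_card_filter]
      exact (Finset.card_filter_le _ _).trans hmsg)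
    (by
      intro τ y
      rcases (V τ y).eq_empty_or_nonempty with h | ⟨v, hv⟩
      · simp [h]
      · obtain ⟨⟨m, x⟩, hp, -⟩ := Finset.mem_image.1 hv
        have hx : x ∈ A τ := Finset.mem_filter.2
          ⟨Finset.mem_univ x, y, m, _, (Finset.mem_filter.1 hp).2⟩
        exact ((hVcard x τ y hx).trans (Finset.card_filter_le _ _)).trans hmsg)
    (by
      intro x
      rw [← Finset.card_image_of_injOn (f := Prod.snd)]
      · refine card_le_of_prefixFree _ ?_ ?_
        · intro l hl
          obtain ⟨τ, hτ, rfl⟩ := Finset.mem_image.1 hl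
          exact mem_bitStrings.1 (Finset.mem_product.1 (Finset.mem_filter.1 hτ).1).2
        · intro l hl l' hl' hpre
          obtain ⟨τ, hτ, rfl⟩ := Finset.mem_image.1 hl
          obtain ⟨τ', hτ', rfl⟩ := Finset.mem_image.1 hl'
          obtain ⟨y, m, g, rfl⟩ := (Finset.mem_filter.1 (Finset.mem_filter.1 hτ).2).2
          obtain ⟨y', m', g', rfl⟩ := (Finset.mem_filter.1 (Finset.mem_filter.1 hτ').2).2
          exact Hpf _ _ _ _ _ _ _ hpre
      · intro τ hτ τ' hτ' h
        obtain ⟨y, m, g, rfl⟩ := (Finset.mem_filter.1 (Finset.mem_filter.1 hτ).2).2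
        obtain ⟨y', m', g', rfl⟩ := (Finset.mem_filter.1 (Finset.mem_filter.1 hτ').2).2
        exact Prod.ext (HA _ _ _ _ _ _ _ h) h)
    (by
      rw [hT, Finset.card_product]
      have h1 := card_bitStrings_lt cA
      have h2 := card_bitStrings_lt cB
      have h3 : 1 ≤ 2 ^ cA := Nat.one_le_two_pow
      have h4 : 1 ≤ 2 ^ cB := Nat.one_le_two_pow
      have h5 := Nat.mul_le_mul h1 h2
      have h6 : (bitStrings cA).card * (bitStrings cB).card
          ≤ (2 * 2 ^ cA - 1) * (2 * 2 ^ cB - 1) := Nat.mul_le_mul (by omega) (by omega)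
      zify [show 1 ≤ 2 * 2 ^ cA by omega, show 1 ≤ 2 * 2 ^ cB by omega] at h6 ⊢
      nlinarith)
    δ hδ (by
      refine Hsolve.trans (Finset.sum_le_sum fun x _ => Finset.sum_le_sum fun y _ => ?_)
      have hxy := mul_nonneg (hμx0 x) (hμy0 y)
      split_ifs with h1 h2
      · exact le_rfl
      · refine absurd ?_ h2
        obtain ⟨hm, hlA, hlB, hout⟩ := h1
        refine ⟨_, Finset.mem_product.2 ⟨mem_bitStrings.2 hlA, mem_bitStrings.2 hlB⟩,
          Finset.mem_filter.2 ⟨Finset.mem_univ x, _, _, _, rfl⟩, ?_⟩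
        exact Finset.mem_image.2 ⟨(Mmer x y, x), Finset.mem_filter.2
          ⟨Finset.mem_product.2 ⟨mem_bitStrings.2 hm, Finset.mem_univ x⟩, rfl⟩, hout⟩
      · exact hxy
      · exact le_rfl)
  push_cast at hS1 hS2
  refine ⟨S, richColumns μx f (δ / (2 * 2 ^ cM)) S, ?_, ?_, ?_⟩
  · intro y hy
    obtain ⟨v, hv⟩ := (Finset.mem_filter.1 hy).2
    refine ⟨v, ?_⟩
    rw [Real.rpow_neg zero_le_two, Real.rpow_natCast, ← mul_assoc, ← div_eq_mul_inv, div_div]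
    exact mul_le_mul_of_nonneg_right hv (hμy0 y)
  · refine le_of_eq_of_le ?_ hS1
    rw [Real.rpow_neg zero_le_two, Real.rpow_add two_pos, Real.rpow_add two_pos,
      Real.rpow_natCast, Real.rpow_natCast, Real.rpow_natCast]
    field_simp
  · refine le_of_eq_of_le ?_ hS2
    rw [Real.rpow_neg zero_le_two, Real.rpow_add two_pos, Real.rpow_natCast, Real.rpow_natCast]
    field_simp
end

section
/- Under the above assumptions, M(f) has a rectangle R = X'×Y' such that X' ⊆ G_X, Y' ⊆ G_Y, R is ((δ−ε)/2)·2^{−c_M}-column-monochromatic, μ_x(X') ≥ (1−ε)·((δ−ε)/4)·2^{−(c_M+c_A+c_B)}, and μ_y(Y') ≥ (1−ε)·((δ−ε)/4)·2^{−(c_M+c_B)}. (This follows from the product-distribution rectangle lemma applied to μ' and δ' = δ−ε, using μ'_x(X') ≤ μ_x(X')/(1−ε).) -/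
section

open Finset

/-- The bit strings of length at most `n` form a finite set with fewer than `2 ^ (n + 1)` elements. -/
lemma exists_finset_boolList_length_le (n : ℕ) :
    ∃ F : Finset (List Bool), (∀ l, l ∈ F ↔ l.length ≤ n) ∧ F.card + 1 ≤ 2 ^ (n + 1) := by
  classical
  induction n with
  | zero => exact ⟨{[]}, by simp, by simp⟩
  | succ n ih =>
    obtain ⟨F, hF, hcard⟩ := ih
    refine ⟨insert [] (F.image (List.cons true) ∪ F.image (List.cons false)), ?_, ?_⟩
    · intro l
      rcases l with _ | ⟨_ | _, l⟩ <;> simp [hF]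
    · have h1 := card_insert_le ([] : List Bool)
        (F.image (List.cons true) ∪ F.image (List.cons false))
      have h2 := card_union_le (F.image (List.cons true)) (F.image (List.cons false))
      have h3 := card_image_le (s := F) (f := List.cons true)
      have h4 := card_image_le (s := F) (f := List.cons false)
      rw [pow_succ]
      omega

/-- A prefix-free set of bit strings of length at most `n` has at most `2 ^ n` elements. -/
lemma card_le_two_pow_of_prefix_free (n : ℕ) (B : Finset (List Bool))
    (hlen : ∀ l ∈ B, l.length ≤ n)
    (hpf : ∀ l ∈ B, ∀ l' ∈ B, l <+: l' → l = l') : B.card ≤ 2 ^ n := by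
  classical
  have hinj : Set.InjOn
      (fun (l : List Bool) (i : Fin n) => (l ++ List.replicate (n - l.length) false).getD i false)
      (B : Set (List Bool)) := by
    intro l hl l' hl' h
    have h1 := hlen l hl
    have h2 := hlen l' hl'
    have heq : l ++ List.replicate (n - l.length) false
        = l' ++ List.replicate (n - l'.length) false := by
      apply List.ext_getElem
      · simp; omega
      · intro i hi hi'
        have hin : i < n := by simp at hi; omega
        have := congrFun h ⟨i, hin⟩
        simp only [List.getD_eq_getElem _ _ hi, List.getD_eq_getElem _ _ hi'] at this
        exact this
    rcases List.prefix_or_prefix_of_prefix (List.prefix_append l _)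
      (heq ▸ List.prefix_append l' _) with hp | hp
    · exact hpf l hl l' hl' hp
    · exact (hpf l' hl' l hl hp).symm
  calc B.card ≤ (univ : Finset (Fin n → Bool)).card :=
        card_le_card_of_injOn _ (fun _ _ => mem_coe.2 (mem_univ _)) hinj
    _ = 2 ^ n := by simp

/-- Any set can be padded to have weight at least `s` while overshooting by at most the largest
weight of a point. -/
lemma exists_superset_sum_le {X : Type*} [Fintype X] (p : X → ℝ) (s η : ℝ)
    (hη : ∀ x, p x ≤ η) (hs : s ≤ ∑ x, p x) (B : Finset X) :
    ∃ X' : Finset X, B ⊆ X' ∧ s ≤ ∑ x ∈ X', p x ∧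
      ∑ x ∈ X', p x ≤ max (∑ x ∈ B, p x) (s + η) := by
  classical
  obtain ⟨X', hX', hmin⟩ := exists_min_image
    ((univ : Finset (Finset X)).filter (fun C => B ⊆ C ∧ s ≤ ∑ x ∈ C, p x)) card
    ⟨univ, by simpa using hs⟩
  simp only [mem_filter, mem_univ, true_and] at hX' hmin
  refine ⟨X', hX'.1, hX'.2, ?_⟩
  by_cases hB : X' ⊆ B
  · rw [hX'.1.antisymm hB]
    exact le_max_left _ _
  · obtain ⟨x, hx, hxB⟩ := not_subset.1 hB
    refine le_max_of_le_right ?_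
    by_contra! hlt
    have hsum := add_sum_erase X' p hx
    have := hmin (X'.erase x)
      ⟨fun z hz => mem_erase.2 ⟨fun h => hxB (h ▸ hz), hX'.1 hz⟩, by linarith [hη x]⟩
    have := card_erase_lt_of_mem hx
    omega

open Classical in
/-- Averaging core of the rectangle lemma. Each good point `(x, y)` carries a message `mer x y`
and a transcript `tau x y`; `A τ` is the set of rows compatible with the transcript `τ`. -/
lemma exists_column_monochromatic_of_transcripts {X Y Z ι κ : Type*} [Fintype X] [Fintype Y]
    (p : X → ℝ) (q : Y → ℝ) (hp : ∀ x, 0 ≤ p x) (hq : ∀ y, 0 ≤ q y)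
    (hp1 : ∑ x, p x = 1) (hq1 : ∑ y, q y = 1) (f : X → Y → Z)
    (T : Finset ι) (Ms : Finset κ) (A : ι → Finset X) (good : X → Y → Prop)
    (mer : X → Y → κ) (tau : X → Y → ι) (δ c s t S : ℝ)
    (hc : 0 < c) (hc2 : c ≤ 1 / 2) (hs : 0 < s) (hs1 : s ≤ 1) (ht1 : t ≤ 1)
    (hsS : s * S = c / 2) (hT : (T.card : ℝ) < 4 * S) (hMs : c * Ms.card ≤ δ - c)
    (hdeg : ∀ x, ((T.filter (fun τ => x ∈ A τ)).card : ℝ) * t ≤ c / 2)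
    (hmer : ∀ x y, good x y → mer x y ∈ Ms)
    (htau : ∀ x y, good x y → tau x y ∈ T)
    (hA : ∀ x y, good x y → x ∈ A (tau x y))
    (hdisj : ∀ x x₁ x₂ y, good x₁ y → good x₂ y → mer x₁ y = mer x₂ y →
      x ∈ A (tau x₁ y) → x ∈ A (tau x₂ y) → tau x₁ y = tau x₂ y)
    (hval : ∀ x₁ x₂ y, good x₁ y → good x₂ y → mer x₁ y = mer x₂ y →
      tau x₁ y = tau x₂ y → f x₁ y = f x₂ y)
    (hgood : δ ≤ ∑ x, ∑ y, if good x y then p x * q y else 0) :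
    ∃ (X' : Finset X) (Y' : Finset Y),
      (∀ y ∈ Y', ∃ v : Z, c * ∑ x ∈ X', p x ≤ ∑ x ∈ X'.filter (fun x => f x y = v), p x)
      ∧ s ≤ ∑ x ∈ X', p x ∧ t ≤ ∑ y ∈ Y', q y := by
  by_contra hno
  push Not at hno
  have hXne : (univ : Finset X).Nonempty := by
    rw [nonempty_iff_ne_empty]
    intro h
    rw [h] at hp1
    simp at hp1
  obtain ⟨x₀, -, hx₀⟩ := exists_max_image univ p hXne
  -- the heaviest point is light
  have hatom : s + p x₀ ≤ s / (1 - c) := by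
    obtain ⟨X', hsub, h1, h2⟩ := exists_superset_sum_le p s (p x₀) (fun x => hx₀ x (mem_univ x))
      (by rw [hp1]; exact hs1) {x₀}
    rw [sum_singleton, max_eq_right (by linarith)] at h2
    by_contra! hlt
    rw [div_lt_iff₀ (by linarith)] at hlt
    have hmono : ∀ y ∈ (univ : Finset Y), ∃ v : Z,
        c * ∑ x ∈ X', p x ≤ ∑ x ∈ X'.filter (fun x => f x y = v), p x := by
      intro y _
      refine ⟨f x₀ y, ?_⟩
      have h3 : p x₀ ≤ ∑ x ∈ X'.filter (fun x => f x y = f x₀ y), p x :=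
        single_le_sum (f := p) (fun x _ => hp x)
          (mem_filter.2 ⟨hsub (mem_singleton_self x₀), rfl⟩)
      nlinarith
    have := hno X' univ hmono h1
    linarith
  set s' := s / (1 - c) with hs'
  have hs'0 : 0 < s' := div_pos hs (by linarith)
  set w : ι → ℝ := fun τ => ∑ x ∈ A τ, p x with hw
  have hw0 : ∀ τ, 0 ≤ w τ := fun τ => sum_nonneg fun x _ => hp x
  set O : ι → Finset Y := fun τ => univ.filter (fun y => ∃ v : Z,
    c * max (w τ) s' ≤ ∑ x ∈ (A τ).filter (fun x => f x y = v), p x) with hO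
  -- few columns are monochromatic on a padded transcript class
  have hOt : ∀ τ, ∑ y ∈ O τ, q y ≤ t := by
    intro τ
    obtain ⟨X', hsub, h1, h2⟩ := exists_superset_sum_le p s (p x₀) (fun x => hx₀ x (mem_univ x))
      (by rw [hp1]; exact hs1) (A τ)
    refine (hno X' (O τ) ?_ h1).le
    intro y hy
    obtain ⟨v, hv⟩ := (mem_filter.1 hy).2
    refine ⟨v, le_trans ?_ (hv.trans ?_)⟩
    · exact mul_le_mul_of_nonneg_left (h2.trans (max_le_max le_rfl hatom)) hc.le
    · exact sum_le_sum_of_subset_of_nonneg (filter_subset_filter _ hsub) fun x _ _ => hp x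
  set ρ : ι → ℝ := fun τ => min (1 - c) (max 0 (1 - w τ / s')) with hρ
  have hρ0 : ∀ τ, 0 ≤ ρ τ := fun τ => le_min (by linarith) (le_max_left _ _)
  have hρw : ∀ τ, ρ τ * w τ ≤ s' / 4 := by
    intro τ
    have h1 : ρ τ ≤ max 0 (1 - w τ / s') := min_le_right _ _
    refine (mul_le_mul_of_nonneg_right h1 (hw0 τ)).trans ?_
    rcases max_cases 0 (1 - w τ / s') with ⟨h, -⟩ | ⟨h, -⟩ <;> rw [h]
    · linarith
    · have h2 : w τ = (w τ / s') * s' := by field_simp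
      set u := w τ / s'
      rw [h2]
      nlinarith [mul_nonneg hs'0.le (sq_nonneg (2 * u - 1))]
  set V : Y → ι → Finset κ := fun y τ =>
    Ms.filter (fun m => ∃ x, good x y ∧ mer x y = m ∧ tau x y = τ) with hV
  set g : Y → ι → ℝ := fun y τ => ∑ x, if good x y ∧ tau x y = τ then p x else 0 with hg
  set h : Y → ι → ℝ := fun y τ => if y ∈ O τ then 1 - c else ρ τ with hh
  have hg0 : ∀ y τ, 0 ≤ g y τ := fun y τ => sum_nonneg fun x _ => by
    split_ifs
    · exact hp x
    · exact le_rfl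
  have hgw : ∀ y τ, g y τ ≤ w τ := by
    intro y τ
    simp only [hg, hw]
    rw [← sum_filter]
    refine sum_le_sum_of_subset_of_nonneg ?_ fun x _ _ => hp x
    intro x hx
    obtain ⟨hx1, hx2⟩ := (mem_filter.1 hx).2
    exact hx2 ▸ hA x y hx1
  have hgV : ∀ y τ, y ∉ O τ → g y τ ≤ (V y τ).card * (c * max (w τ) s') := by
    intro y τ hy
    have h1 : g y τ ≤ ∑ m ∈ V y τ,
        ∑ x, if good x y ∧ tau x y = τ ∧ mer x y = m then p x else 0 := by
      rw [sum_comm]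
      refine sum_le_sum fun x _ => ?_
      have hnn : ∀ m ∈ V y τ,
          0 ≤ if good x y ∧ tau x y = τ ∧ mer x y = m then p x else 0 := fun m _ => by
        split_ifs
        · exact hp x
        · exact le_rfl
      split_ifs with hx
      · refine le_trans ?_ (single_le_sum hnn
          (mem_filter.2 ⟨hmer x y hx.1, x, hx.1, rfl, hx.2⟩ : mer x y ∈ V y τ))
        simp [hx.1, hx.2]
      · exact sum_nonneg hnn
    refine h1.trans ?_
    rw [← nsmul_eq_mul]
    refine sum_le_card_nsmul _ _ _ fun m hm => ?_
    obtain ⟨x₁, hx1, hx2, hx3⟩ := (mem_filter.1 hm).2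
    have hno' : ¬ ∃ v : Z,
        c * max (w τ) s' ≤ ∑ x ∈ (A τ).filter (fun x => f x y = v), p x := fun hex =>
      hy (mem_filter.2 ⟨mem_univ y, hex⟩)
    push Not at hno'
    refine le_trans ?_ (hno' (f x₁ y)).le
    rw [← sum_filter]
    refine sum_le_sum_of_subset_of_nonneg ?_ fun x _ _ => hp x
    intro x hx
    obtain ⟨ha, hb, hd⟩ := (mem_filter.1 hx).2
    exact mem_filter.2 ⟨hb ▸ hA x y ha,
      hval x x₁ y ha hx1 (hd.trans hx2.symm) (hb.trans hx3.symm)⟩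
  have hVpos : ∀ y τ, 0 < g y τ → (1 : ℝ) ≤ (V y τ).card := by
    intro y τ hpos
    obtain ⟨x, -, hx⟩ := exists_ne_zero_of_sum_ne_zero hpos.ne'
    have hx' : good x y ∧ tau x y = τ := by
      by_contra hcon
      simp [hcon] at hx
    have : 0 < (V y τ).card :=
      card_pos.2 ⟨mer x y, mem_filter.2 ⟨hmer x y hx'.1, x, hx'.1, rfl, hx'.2⟩⟩
    exact_mod_cast this
  have hkey : ∀ y τ, g y τ ≤ c * ((V y τ).card * w τ) + h y τ * g y τ := by
    intro y τ
    have hn0 : (0 : ℝ) ≤ (V y τ).card := Nat.cast_nonneg _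
    rcases (hg0 y τ).eq_or_lt with hz | hpos
    · rw [← hz]
      have := mul_nonneg hc.le (mul_nonneg hn0 (hw0 τ))
      linarith
    have hfull : g y τ ≤ c * ((V y τ).card * w τ) + (1 - c) * g y τ := by
      have h1 : g y τ ≤ (V y τ).card * w τ :=
        (hgw y τ).trans (le_mul_of_one_le_left (hw0 τ) (hVpos y τ hpos))
      nlinarith
    by_cases hy : y ∈ O τ
    · simpa [hh, hy] using hfull
    · simp only [hh, hy, if_false, hρ]
      rcases min_cases (1 - c) (max 0 (1 - w τ / s')) with ⟨he, -⟩ | ⟨he, -⟩ <;> rw [he]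
      · exact hfull
      · have h1 := hgV y τ hy
        rcases le_total s' (w τ) with hle | hle
        · rw [max_eq_left hle] at h1
          have := mul_nonneg (le_max_left 0 (1 - w τ / s')) hpos.le
          linarith
        · rw [max_eq_right hle] at h1
          have h2 : 1 - w τ / s' ≤ max 0 (1 - w τ / s') := le_max_right _ _
          have h3 : w τ = (w τ / s') * s' := by field_simp
          have hu0 : 0 ≤ w τ / s' := div_nonneg (hw0 τ) hs'0.le
          have h4 : (w τ / s') * g y τ ≤ c * ((V y τ).card * w τ) := by
            calc (w τ / s') * g y τ ≤ (w τ / s') * ((V y τ).card * (c * s')) :=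
                  mul_le_mul_of_nonneg_left h1 hu0
              _ = c * ((V y τ).card * ((w τ / s') * s')) := by ring
              _ = c * ((V y τ).card * w τ) := by rw [← h3]
          nlinarith [mul_le_mul_of_nonneg_right h2 hpos.le]
  -- for each message the transcript classes in use are disjoint
  have hcover : ∀ y, ∑ τ ∈ T, ((V y τ).card : ℝ) * w τ ≤ Ms.card := by
    intro y
    have h1 : ∀ τ, ((V y τ).card : ℝ) * w τ = ∑ m ∈ Ms, ∑ x,
        if (∃ x₁, good x₁ y ∧ mer x₁ y = m ∧ tau x₁ y = τ) ∧ x ∈ A τ then p x else 0 := by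
      intro τ
      rw [← nsmul_eq_mul, ← sum_const, hV, sum_filter]
      refine sum_congr rfl fun m _ => ?_
      by_cases hm : ∃ x₁, good x₁ y ∧ mer x₁ y = m ∧ tau x₁ y = τ
      · simp only [hm, if_true, true_and, hw]
        rw [← sum_filter]
        congr 1
        ext x
        simp
      · simp [hm]
    simp only [h1]
    rw [sum_comm]
    have h2 : ∀ m ∈ Ms, ∑ τ ∈ T, ∑ x,
        (if (∃ x₁, good x₁ y ∧ mer x₁ y = m ∧ tau x₁ y = τ) ∧ x ∈ A τ then p x else 0) ≤ 1 := by
      intro m _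
      rw [sum_comm, ← hp1]
      refine sum_le_sum fun x _ => ?_
      rw [← sum_filter, sum_const, nsmul_eq_mul]
      have hcard : (T.filter (fun τ =>
          (∃ x₁, good x₁ y ∧ mer x₁ y = m ∧ tau x₁ y = τ) ∧ x ∈ A τ)).card ≤ 1 := by
        rw [card_le_one]
        intro τ hτ τ' hτ'
        obtain ⟨⟨x₁, a1, a2, a3⟩, a4⟩ := (mem_filter.1 hτ).2
        obtain ⟨⟨x₂, b1, b2, b3⟩, b4⟩ := (mem_filter.1 hτ').2
        subst a3 b3
        exact hdisj x x₁ x₂ y a1 b1 (a2.trans b2.symm) a4 b4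
      exact mul_le_of_le_one_left (hp x) (by exact_mod_cast hcard)
    simpa using sum_le_card_nsmul _ _ _ h2
  have hsplit : ∀ (k : Y → ι → ℝ), ∑ x, ∑ y, (if good x y then p x * q y * k y (tau x y) else 0)
      = ∑ y, q y * ∑ τ ∈ T, k y τ * g y τ := by
    intro k
    rw [sum_comm]
    refine sum_congr rfl fun y _ => ?_
    simp only [hg, mul_sum]
    rw [sum_comm]
    refine sum_congr rfl fun x _ => ?_
    by_cases hx : good x y
    · simp only [hx, if_true, true_and]
      rw [sum_eq_single_of_mem (tau x y) (htau x y hx)]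
      · rw [if_pos rfl]; ring
      · intro τ _ hτ
        rw [if_neg (Ne.symm hτ)]; ring
    · simp [hx]
  set R : X → ℝ := fun x => ∑ τ ∈ T.filter (fun τ => x ∈ A τ), ρ τ with hR
  have hR0 : ∀ x, 0 ≤ R x := fun x => sum_nonneg fun τ _ => hρ0 τ
  have hrow : ∀ x, ∑ y, (if good x y then q y * h y (tau x y) else 0)
      ≤ (1 - c) * c / 2 + (1 - c / 2) * R x := by
    intro x
    set r := min (R x) (1 - c) with hr
    have hr0 : 0 ≤ r := le_min (hR0 x) (by linarith)
    have hr1 : r ≤ 1 - c := min_le_right _ _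
    have ho : ∑ y, (if good x y ∧ y ∈ O (tau x y) then q y else 0) ≤ c / 2 := by
      have h1 : ∑ y, (if good x y ∧ y ∈ O (tau x y) then q y else 0)
          ≤ ∑ τ ∈ T.filter (fun τ => x ∈ A τ), ∑ y ∈ O τ, q y := by
        have h2 : ∀ τ, ∑ y ∈ O τ, q y = ∑ y, if y ∈ O τ then q y else 0 := by
          intro τ
          rw [← sum_filter]
          congr 1
          ext y
          simp
        simp only [h2]
        rw [sum_comm]
        refine sum_le_sum fun y _ => ?_
        have hnn : ∀ τ ∈ T.filter (fun τ => x ∈ A τ), 0 ≤ if y ∈ O τ then q y else 0 :=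
          fun τ _ => by
            split_ifs
            · exact hq y
            · exact le_rfl
        by_cases hx : good x y ∧ y ∈ O (tau x y)
        · rw [if_pos hx]
          refine le_trans ?_ (single_le_sum hnn
            (mem_filter.2 ⟨htau x y hx.1, hA x y hx.1⟩ :
              tau x y ∈ T.filter (fun τ => x ∈ A τ)))
          rw [if_pos hx.2]
        · rw [if_neg hx]
          exact sum_nonneg hnn
      refine h1.trans (le_trans ?_ (hdeg x))
      rw [← nsmul_eq_mul]
      exact sum_le_card_nsmul _ _ _ fun τ _ => hOt τ
    have hpt : ∀ y, (if good x y then q y * h y (tau x y) else 0)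
        ≤ q y * r + (1 - c - r) * (if good x y ∧ y ∈ O (tau x y) then q y else 0) := by
      intro y
      by_cases hx : good x y
      · by_cases hy : y ∈ O (tau x y)
        · simp only [hx, hy, hh, and_self, if_true]
          linarith
        · simp only [hx, hy, hh, and_false, if_false, if_true, mul_zero, add_zero]
          refine mul_le_mul_of_nonneg_left (le_min ?_ (min_le_left _ _)) (hq y)
          exact single_le_sum (f := ρ) (fun τ _ => hρ0 τ)
            (mem_filter.2 ⟨htau x y hx, hA x y hx⟩)
      · simp only [hx, false_and, if_false, mul_zero, add_zero]
        exact mul_nonneg (hq y) hr0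
    refine (sum_le_sum fun y _ => hpt y).trans ?_
    rw [sum_add_distrib, ← sum_mul, ← mul_sum, hq1]
    have hrR : r ≤ R x := min_le_left _ _
    nlinarith [mul_le_mul_of_nonneg_left ho (by linarith : 0 ≤ 1 - c - r),
      mul_le_mul_of_nonneg_left hrR (by linarith : 0 ≤ 1 - c / 2)]
  have hRsum : ∑ x, p x * R x < S * s' := by
    have h1 : ∑ x, p x * R x = ∑ τ ∈ T, ρ τ * w τ := by
      simp only [hR, hw, mul_sum, sum_filter]
      rw [sum_comm]
      refine sum_congr rfl fun τ _ => ?_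
      have h2 : ∑ x ∈ A τ, ρ τ * p x = ∑ x, if x ∈ A τ then ρ τ * p x else 0 := by
        rw [← sum_filter]
        congr 1
        ext x
        simp
      rw [h2]
      refine sum_congr rfl fun x _ => ?_
      split_ifs <;> ring
    have h3 := sum_le_card_nsmul T (fun τ => ρ τ * w τ) (s' / 4) fun τ _ => hρw τ
    rw [nsmul_eq_mul] at h3
    rw [h1]
    nlinarith [mul_lt_mul_of_pos_right hT hs'0]
  have hover : ∑ y, q y * ∑ τ ∈ T, h y τ * g y τ
      ≤ (1 - c) * c / 2 + (1 - c / 2) * ∑ x, p x * R x := by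
    rw [← hsplit h]
    calc ∑ x, ∑ y, (if good x y then p x * q y * h y (tau x y) else 0)
        = ∑ x, p x * ∑ y, (if good x y then q y * h y (tau x y) else 0) := by
          simp only [mul_sum]
          refine sum_congr rfl fun x _ => sum_congr rfl fun y _ => ?_
          split_ifs <;> ring
      _ ≤ ∑ x, p x * ((1 - c) * c / 2 + (1 - c / 2) * R x) :=
          sum_le_sum fun x _ => mul_le_mul_of_nonneg_left (hrow x) (hp x)
      _ = (∑ x, p x) * ((1 - c) * c / 2) + (1 - c / 2) * ∑ x, p x * R x := by
          rw [sum_mul, mul_sum, ← sum_add_distrib]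
          exact sum_congr rfl fun x _ => by ring
      _ = _ := by rw [hp1, one_mul]
  have htotal : δ ≤ c * Ms.card + ∑ y, q y * ∑ τ ∈ T, h y τ * g y τ := by
    have h1 := hsplit fun _ _ => 1
    simp only [mul_one, one_mul] at h1
    refine hgood.trans (h1.le.trans ?_)
    calc ∑ y, q y * ∑ τ ∈ T, g y τ
        ≤ ∑ y, q y * (c * Ms.card + ∑ τ ∈ T, h y τ * g y τ) := by
          refine sum_le_sum fun y _ => mul_le_mul_of_nonneg_left ?_ (hq y)
          refine (sum_le_sum fun τ _ => hkey y τ).trans ?_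
          rw [sum_add_distrib, ← mul_sum]
          linarith [mul_le_mul_of_nonneg_left (hcover y) hc.le]
      _ = (∑ y, q y) * (c * Ms.card) + ∑ y, q y * ∑ τ ∈ T, h y τ * g y τ := by
          rw [sum_mul, ← sum_add_distrib]
          exact sum_congr rfl fun y _ => by ring
      _ = _ := by rw [hq1, one_mul]
  have hSs' : S * s' * (1 - c) = c / 2 := by
    have : 1 - c ≠ 0 := by linarith
    rw [hs', ← hsS]
    field_simp
  have hfin : (1 - c) * c / 2 + (1 - c / 2) * (S * s') ≤ c := by
    have h1 : 0 < 1 - c := by linarith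
    refine le_of_mul_le_mul_right ?_ h1
    have h2 : ((1 - c) * c / 2 + (1 - c / 2) * (S * s')) * (1 - c)
        = (1 - c) * c / 2 * (1 - c) + (1 - c / 2) * (c / 2) := by
      rw [← hSs']; ring
    rw [h2]
    nlinarith [mul_nonneg (mul_nonneg hc.le hc.le) (by linarith : 0 ≤ 1 / 2 - c)]
  nlinarith [mul_lt_mul_of_pos_left hRsum (by linarith : 0 < 1 - c / 2)]

/-- The sum of a conditioned weight is the weight of the part in the conditioning set, rescaled. -/
lemma sum_ite_mem_div {X : Type*} [DecidableEq X] (μ : X → ℝ) (G B : Finset X) (P : ℝ) :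
    ∑ x ∈ B, (if x ∈ G then μ x / P else 0) = (∑ x ∈ B ∩ G, μ x) / P := by
  rw [sum_ite_mem, sum_div]

open Classical in
/-- Conditioning a product distribution on a rectangle of weight at least `1 - ε` lowers the
probability of an event by at most `ε`. -/
lemma sub_le_sum_conditioned {X Y : Type*} [Fintype X] [Fintype Y] (μx : X → ℝ) (μy : Y → ℝ)
    (hμx0 : ∀ x, 0 ≤ μx x) (hμy0 : ∀ y, 0 ≤ μy y)
    (hμx1 : ∑ x, μx x = 1) (hμy1 : ∑ y, μy y = 1) (GX : Finset X) (GY : Finset Y)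
    (good : X → Y → Prop) (δ ε : ℝ) (hεδ : ε < δ)
    (hPX : 0 < ∑ x ∈ GX, μx x) (hPY : 0 < ∑ y ∈ GY, μy y)
    (HG : 1 - ε ≤ (∑ x ∈ GX, μx x) * (∑ y ∈ GY, μy y))
    (hgood : δ ≤ ∑ x, ∑ y, if good x y then μx x * μy y else 0) :
    δ - ε ≤ ∑ x, ∑ y, if good x y then
      (if x ∈ GX then μx x / ∑ x ∈ GX, μx x else 0) *
        (if y ∈ GY then μy y / ∑ y ∈ GY, μy y else 0) else 0 := by
  set PX := ∑ x ∈ GX, μx x with hPXd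
  set PY := ∑ y ∈ GY, μy y with hPYd
  have hP : 0 < PX * PY := mul_pos hPX hPY
  have hPX1 : PX ≤ 1 := hμx1 ▸ sum_le_univ_sum_of_nonneg hμx0
  have hPY1 : PY ≤ 1 := hμy1 ▸ sum_le_univ_sum_of_nonneg hμy0
  have hin : ∑ x, ∑ y, (if x ∈ GX ∧ y ∈ GY then μx x * μy y else 0) = PX * PY := by
    have hX : PX = ∑ x, if x ∈ GX then μx x else 0 := by simp [hPXd]
    have hY : PY = ∑ y, if y ∈ GY then μy y else 0 := by simp [hPYd]
    rw [hX, hY, sum_mul_sum]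
    refine sum_congr rfl fun x _ => sum_congr rfl fun y _ => ?_
    split_ifs <;> simp_all
  have hall : ∑ x, ∑ y, μx x * μy y = 1 := by
    rw [← sum_mul_sum, hμx1, hμy1, one_mul]
  have hinter : δ - 1 + PX * PY ≤
      ∑ x, ∑ y, if good x y ∧ x ∈ GX ∧ y ∈ GY then μx x * μy y else 0 := by
    have hpt : ∀ x y, (if good x y then μx x * μy y else 0)
          + (if x ∈ GX ∧ y ∈ GY then μx x * μy y else 0) ≤
        μx x * μy y + if good x y ∧ x ∈ GX ∧ y ∈ GY then μx x * μy y else 0 := by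
      intro x y
      have h0 := mul_nonneg (hμx0 x) (hμy0 y)
      by_cases h1 : good x y <;> by_cases h2 : x ∈ GX ∧ y ∈ GY <;> simp [h1, h2, h0]
    have hsum := sum_le_sum fun x (_ : x ∈ univ) => sum_le_sum fun y (_ : y ∈ univ) => hpt x y
    simp only [sum_add_distrib] at hsum
    rw [hin, hall] at hsum
    linarith
  have hscale : (∑ x, ∑ y, if good x y ∧ x ∈ GX ∧ y ∈ GY then μx x * μy y else 0) / (PX * PY)
      = ∑ x, ∑ y, if good x y then
        (if x ∈ GX then μx x / PX else 0) * (if y ∈ GY then μy y / PY else 0) else 0 := by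
    simp only [sum_div]
    refine sum_congr rfl fun x _ => sum_congr rfl fun y _ => ?_
    by_cases h1 : good x y <;> by_cases h2 : x ∈ GX <;> by_cases h3 : y ∈ GY <;>
      simp [h1, h2, h3, div_mul_div_comm]
  rw [← hscale, le_div_iff₀ hP]
  nlinarith [mul_le_one₀ hPX1 hPY.le hPY1]

end


open Classical Real Finset in
/-- Conditioned version of the rectangle lemma: if a valid `4ANC` protocol
`δ`-solves `f` under a product distribution `μ = μx × μy` with cost
`(c_A,c_B,c_M)` and `G_X, G_Y` are sets with `Pr_μ[x ∈ G_X ∧ y ∈ G_Y] ≥ 1 − ε`,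
then the communication matrix of `f` has a rectangle `X' × Y'` with `X' ⊆ G_X`,
`Y' ⊆ G_Y`, which is `((δ−ε)/2)·2^{−c_M}`-column-monochromatic, with
`μx(X') ≥ (1−ε)·((δ−ε)/4)·2^{−(c_M+c_A+c_B)}` and
`μy(Y') ≥ (1−ε)·((δ−ε)/4)·2^{−(c_M+c_B)}`. -/
theorem stmt6 {X Y Z : Type} [Fintype X] [Fintype Y] [DecidableEq Z]
    (μx : X → ℝ) (μy : Y → ℝ)
    (hμx0 : ∀ x, 0 ≤ μx x) (hμy0 : ∀ y, 0 ≤ μy y)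
    (hμx1 : ∑ x, μx x = 1) (hμy1 : ∑ y, μy y = 1)
    (f : X → Y → Z) (cA cB cM : ℕ) (δ ε : ℝ)
    (hδ : 0 < δ) (hδ1 : δ ≤ 1) (hε : 0 ≤ ε) (hεδ : ε < δ)
    (GX : Finset X) (GY : Finset Y)
    (HG : 1 - ε ≤ (∑ x ∈ GX, μx x) * (∑ y ∈ GY, μy y))
    (Mmer : X → Y → List Bool)
    (Mmeg : X → Y → List Bool → List Bool)
    (run : X → Y → List Bool → List Bool → List Bool × List Bool)
    (proceed : Y → List Bool → List Bool → List Bool × List Bool → Bool)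
    (out : Y → List Bool → List Bool → List Bool × List Bool → Z)
    (Hrect : ∀ x x' y y' m m' g g',
      run x y m g = run x' y' m' g' → run x y' m' g' = run x y m g)
    (HA : ∀ x y y' m m' g g',
      (run x y m g).2 = (run x y' m' g').2 → (run x y m g).1 = (run x y' m' g').1)
    (Hpf : ∀ x y y' m m' g g',
      (run x y m g).2 <+: (run x y' m' g').2 → (run x y m g).2 = (run x y' m' g').2)
    (Hvalid : ∀ x y m g,
      proceed y m g (run x y m g) = true ↔ g = Mmeg x y m)
    (Hsolve : δ ≤ ∑ x, ∑ y,
      (if (Mmer x y).length ≤ cM ∧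
          (run x y (Mmer x y) (Mmeg x y (Mmer x y))).1.length ≤ cA ∧
          (run x y (Mmer x y) (Mmeg x y (Mmer x y))).2.length ≤ cB ∧
          out y (Mmer x y) (Mmeg x y (Mmer x y))
            (run x y (Mmer x y) (Mmeg x y (Mmer x y))) = f x y
        then μx x * μy y else 0)) :
    ∃ (X' : Finset X) (Y' : Finset Y),
      X' ⊆ GX ∧ Y' ⊆ GY
      ∧ (∀ y ∈ Y', ∃ v : Z,
          (δ - ε) / 2 * 2 ^ (-(cM : ℝ)) * ((∑ x ∈ X', μx x) * μy y) ≤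
            (∑ x ∈ X'.filter (fun x => f x y = v), μx x) * μy y)
      ∧ (1 - ε) * ((δ - ε) / 4) * 2 ^ (-((cM : ℝ) + cA + cB)) ≤ ∑ x ∈ X', μx x
      ∧ (1 - ε) * ((δ - ε) / 4) * 2 ^ (-((cM : ℝ) + cB)) ≤ ∑ y ∈ Y', μy y := by
  classical
  set PX := ∑ x ∈ GX, μx x with hPXd
  set PY := ∑ y ∈ GY, μy y with hPYd
  have hPX1 : PX ≤ 1 := hμx1 ▸ Finset.sum_le_univ_sum_of_nonneg hμx0
  have hPY1 : PY ≤ 1 := hμy1 ▸ Finset.sum_le_univ_sum_of_nonneg hμy0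
  have hPX0 : 0 ≤ PX := Finset.sum_nonneg fun x _ => hμx0 x
  have hPY0 : 0 ≤ PY := Finset.sum_nonneg fun y _ => hμy0 y
  have hε1 : 0 < 1 - ε := by linarith
  have hPXε : 1 - ε ≤ PX := HG.trans (mul_le_of_le_one_right hPX0 hPY1)
  have hPYε : 1 - ε ≤ PY := HG.trans (mul_le_of_le_one_left hPY0 hPX1)
  have hPX : 0 < PX := hε1.trans_le hPXε
  have hPY : 0 < PY := hε1.trans_le hPYε
  obtain ⟨FA, hFA, hFAc⟩ := exists_finset_boolList_length_le cA
  obtain ⟨FB, hFB, hFBc⟩ := exists_finset_boolList_length_le cB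
  obtain ⟨FM, hFM, hFMc⟩ := exists_finset_boolList_length_le cM
  have hFAr : (FA.card : ℝ) + 1 ≤ 2 ^ cA * 2 := by rw [← pow_succ]; exact_mod_cast hFAc
  have hFBr : (FB.card : ℝ) + 1 ≤ 2 ^ cB * 2 := by rw [← pow_succ]; exact_mod_cast hFBc
  have hFMr : (FM.card : ℝ) + 1 ≤ 2 ^ cM * 2 := by rw [← pow_succ]; exact_mod_cast hFMc
  have hM : (2 : ℝ) ^ (-(cM : ℝ)) = (2 ^ cM)⁻¹ := by
    rw [Real.rpow_neg two_pos.le, Real.rpow_natCast]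
  have hMAB : (2 : ℝ) ^ (-((cM : ℝ) + cA + cB)) = (2 ^ cM * 2 ^ cA * 2 ^ cB)⁻¹ := by
    rw [Real.rpow_neg two_pos.le, Real.rpow_add two_pos, Real.rpow_add two_pos,
      Real.rpow_natCast, Real.rpow_natCast, Real.rpow_natCast]
  have hMB : (2 : ℝ) ^ (-((cM : ℝ) + cB)) = (2 ^ cM * 2 ^ cB)⁻¹ := by
    rw [Real.rpow_neg two_pos.le, Real.rpow_add two_pos, Real.rpow_natCast, Real.rpow_natCast]
  rw [hM, hMAB, hMB]
  have ha1 : (1 : ℝ) ≤ 2 ^ cA := one_le_pow₀ one_le_two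
  have hb1 : (1 : ℝ) ≤ 2 ^ cB := one_le_pow₀ one_le_two
  have hm1 : (1 : ℝ) ≤ 2 ^ cM := one_le_pow₀ one_le_two
  set a : ℝ := 2 ^ cA with ha
  set b : ℝ := 2 ^ cB with hb
  set M : ℝ := 2 ^ cM with hMd
  have hmi : M⁻¹ ≤ 1 := inv_le_one_of_one_le₀ hm1
  have hmi0 : 0 < M⁻¹ := by positivity
  have hd0 : 0 < δ - ε := by linarith
  have hMab : (M * a * b)⁻¹ ≤ 1 :=
    inv_le_one_of_one_le₀ (one_le_mul_of_one_le_of_one_le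
      (one_le_mul_of_one_le_of_one_le hm1 ha1) hb1)
  have hMb : (M * b)⁻¹ ≤ 1 := inv_le_one_of_one_le₀ (one_le_mul_of_one_le_of_one_le hm1 hb1)
  have hMab0 : 0 < (M * a * b)⁻¹ := by positivity
  have hMb0 : 0 < (M * b)⁻¹ := by positivity
  set good : X → Y → Prop := fun x y => (Mmer x y).length ≤ cM ∧
    (run x y (Mmer x y) (Mmeg x y (Mmer x y))).1.length ≤ cA ∧
    (run x y (Mmer x y) (Mmeg x y (Mmer x y))).2.length ≤ cB ∧
    out y (Mmer x y) (Mmeg x y (Mmer x y))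
      (run x y (Mmer x y) (Mmeg x y (Mmer x y))) = f x y with hgood
  set tau : X → Y → List Bool × List Bool :=
    fun x y => run x y (Mmer x y) (Mmeg x y (Mmer x y)) with htau
  set A : List Bool × List Bool → Finset X :=
    fun τ => Finset.univ.filter (fun x => ∃ y m g, run x y m g = τ) with hA
  -- a row compatible with the transcript of `(x₁, y)` receives the same second message
  have hmeg : ∀ x x₁ y, x ∈ A (tau x₁ y) →
      run x y (Mmer x₁ y) (Mmeg x₁ y (Mmer x₁ y)) = tau x₁ y ∧
        Mmeg x₁ y (Mmer x₁ y) = Mmeg x y (Mmer x₁ y) := by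
    intro x x₁ y hx
    obtain ⟨y', m', g', hrun⟩ := (Finset.mem_filter.1 hx).2
    have h1 : run x y (Mmer x₁ y) (Mmeg x₁ y (Mmer x₁ y)) = tau x₁ y :=
      (Hrect x x₁ y' y m' (Mmer x₁ y) g' (Mmeg x₁ y (Mmer x₁ y)) hrun).trans hrun
    refine ⟨h1, (Hvalid x y _ _).1 ?_⟩
    rw [h1]
    exact (Hvalid x₁ y _ _).2 rfl
  have hsolve := sub_le_sum_conditioned μx μy hμx0 hμy0 hμx1 hμy1 GX GY good δ ε hεδ hPX hPY HG
    (Hsolve.trans_eq (Finset.sum_congr rfl fun x _ => Finset.sum_congr rfl fun y _ => by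
      congr 1))
  rw [← hPXd, ← hPYd] at hsolve
  obtain ⟨X', Y', hmono, hX', hY'⟩ := exists_column_monochromatic_of_transcripts
    (fun x => if x ∈ GX then μx x / PX else 0) (fun y => if y ∈ GY then μy y / PY else 0)
    (fun x => by
      split_ifs
      · exact div_nonneg (hμx0 x) hPX0
      · exact le_rfl)
    (fun y => by
      split_ifs
      · exact div_nonneg (hμy0 y) hPY0
      · exact le_rfl)
    (by rw [sum_ite_mem_div, Finset.univ_inter, div_self hPX.ne'])
    (by rw [sum_ite_mem_div, Finset.univ_inter, div_self hPY.ne'])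
    f (FA ×ˢ FB) FM A good Mmer tau (δ - ε) ((δ - ε) / 2 * M⁻¹)
    ((δ - ε) / 4 * (M * a * b)⁻¹) ((δ - ε) / 4 * (M * b)⁻¹) (a * b)
    (by positivity) (by nlinarith) (by positivity) (by nlinarith) (by nlinarith)
    (by field_simp; norm_num)
    (by
      rw [Finset.card_product]
      push_cast
      nlinarith [Nat.cast_nonneg (α := ℝ) FA.card, Nat.cast_nonneg (α := ℝ) FB.card])
    (by
      have h1 : M⁻¹ * M = 1 := inv_mul_cancel₀ (by positivity)
      calc (δ - ε) / 2 * M⁻¹ * FM.card ≤ (δ - ε) / 2 * M⁻¹ * (M * 2 - 1) :=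
            mul_le_mul_of_nonneg_left (by linarith) (by positivity)
        _ = (δ - ε) * (M⁻¹ * M) - (δ - ε) / 2 * M⁻¹ := by ring
        _ ≤ _ := by rw [h1, mul_one])
    (by
      intro x
      have hrun : ∀ τ ∈ (FA ×ˢ FB).filter (fun τ => x ∈ A τ), τ.2.length ≤ cB ∧
          ∃ y m g, run x y m g = τ := fun τ hτ =>
        ⟨(hFB _).1 (Finset.mem_product.1 (Finset.mem_filter.1 hτ).1).2,
          (Finset.mem_filter.1 (Finset.mem_filter.1 hτ).2).2⟩
      have hinj : Set.InjOn Prod.snd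
          (((FA ×ˢ FB).filter (fun τ => x ∈ A τ) : Finset (List Bool × List Bool)) :
            Set (List Bool × List Bool)) := by
        intro τ hτ τ' hτ' he
        obtain ⟨-, y, m, g, rfl⟩ := hrun τ hτ
        obtain ⟨-, y', m', g', rfl⟩ := hrun τ' hτ'
        exact Prod.ext (HA _ _ _ _ _ _ _ he) he
      have hcard : ((FA ×ˢ FB).filter (fun τ => x ∈ A τ)).card ≤ 2 ^ cB := by
        rw [← Finset.card_image_of_injOn hinj]
        refine card_le_two_pow_of_prefix_free cB _ ?_ ?_
        · intro l hl
          obtain ⟨τ, hτ, rfl⟩ := Finset.mem_image.1 hl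
          exact (hrun τ hτ).1
        · intro l hl l' hl' hp
          obtain ⟨τ, hτ, rfl⟩ := Finset.mem_image.1 hl
          obtain ⟨τ', hτ', rfl⟩ := Finset.mem_image.1 hl'
          obtain ⟨-, y, m, g, rfl⟩ := hrun τ hτ
          obtain ⟨-, y', m', g', rfl⟩ := hrun τ' hτ'
          exact Hpf _ _ _ _ _ _ _ hp
      have hcard' : (((FA ×ˢ FB).filter (fun τ => x ∈ A τ)).card : ℝ) ≤ b := by
        rw [hb]
        exact_mod_cast hcard
      calc _ ≤ b * ((δ - ε) / 4 * (M * b)⁻¹) :=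
            mul_le_mul_of_nonneg_right hcard' (by positivity)
        _ = (δ - ε) / 2 * M⁻¹ / 2 := by field_simp; norm_num)
    (fun x y hg => (hFM _).2 hg.1)
    (fun x y hg => Finset.mem_product.2 ⟨(hFA _).2 hg.2.1, (hFB _).2 hg.2.2.1⟩)
    (fun x y _ => Finset.mem_filter.2 ⟨Finset.mem_univ x, y, _, _, rfl⟩)
    (by
      intro x x₁ x₂ y _ _ hm hx₁ hx₂
      obtain ⟨h1, h2⟩ := hmeg x x₁ y hx₁
      obtain ⟨h3, h4⟩ := hmeg x x₂ y hx₂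
      rw [← h1, ← h3, h2, h4, hm])
    (by
      intro x₁ x₂ y hg₁ hg₂ hm ht
      have h2 := (hmeg x₂ x₁ y
        (ht ▸ Finset.mem_filter.2 ⟨Finset.mem_univ x₂, y, _, _, rfl⟩)).2
      rw [hm] at h2
      have e1 : out y (Mmer x₁ y) (Mmeg x₁ y (Mmer x₁ y)) (tau x₁ y) = f x₁ y := hg₁.2.2.2
      have e2 : out y (Mmer x₂ y) (Mmeg x₂ y (Mmer x₂ y)) (tau x₂ y) = f x₂ y := hg₂.2.2.2
      rw [← e1, ← e2, ht, hm, h2])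
    hsolve
  rw [sum_ite_mem_div, le_div_iff₀ hPX] at hX'
  rw [sum_ite_mem_div, le_div_iff₀ hPY] at hY'
  refine ⟨X' ∩ GX, Y' ∩ GY, Finset.inter_subset_right, Finset.inter_subset_right, ?_, ?_, ?_⟩
  · intro y hy
    obtain ⟨v, hv⟩ := hmono y (Finset.mem_inter.1 hy).1
    refine ⟨v, ?_⟩
    rw [sum_ite_mem_div, sum_ite_mem_div, ← mul_div_assoc, div_le_div_iff_of_pos_right hPX] at hv
    have he : X'.filter (fun x => f x y = v) ∩ GX = (X' ∩ GX).filter (fun x => f x y = v) := by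
      ext x
      simp only [Finset.mem_inter, Finset.mem_filter]
      tauto
    rw [← mul_assoc, ← he]
    refine mul_le_mul_of_nonneg_right (hv.trans_eq ?_) (hμy0 y)
    congr!
  · have := mul_le_mul_of_nonneg_left hPXε (by positivity : 0 ≤ (δ - ε) / 4 * (M * a * b)⁻¹)
    linarith
  · have := mul_le_mul_of_nonneg_left hPYε (by positivity : 0 ≤ (δ - ε) / 4 * (M * b)⁻¹)
    linarith
end
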